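/- arXiv:2405.03811 — 4 statements merged into one kernel-verified Lean document; each statement's English description precedes it below -/
import Mathlib

section
/- Let m, n ≥ 1. For each d ≥ 1 let P(d) ⊂ (ℝ/dℤ)^m be a finite set, and for q ∈ ℤ₊^n let P(q) be the lift to ℝ^m of P(gcd(q)). If r ≤ (1/2)·min{|p₁−p₂| : p₁,p₂ ∈ P(q), p₁ ≠ p₂}, then Leb(A_{n,m}^P(q,r)) = #P(gcd(q)) · (2r/gcd(q))^m, where A_{n,m}^P(q,r) = {X ∈ 𝕋^{nm} : qX ∈ B(0,r) + P(q)} is viewed as a subset of the torus 𝕋^{nm} of n×m real matrices modulo ℤ^{nm}. -/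
open MeasureTheory
open scoped ENNReal

/-- The lift to `ℝ^m` of the finite set `P d ⊆ (ℝ/dℤ)^m` (given by representatives):
all translates of points of `P d` by vectors in `d·ℤ^m`. -/
def liftSet (m : ℕ) (P : ℕ → Finset (Fin m → ℝ)) (d : ℕ) : Set (Fin m → ℝ) :=
  {x | ∃ p ∈ P d, ∃ k : Fin m → ℤ, x = p + (d : ℝ) • fun j => ((k j : ℤ) : ℝ)}

/-- `A_{n,m}^P(q,r) ⊆ 𝕋^{nm}`: the set of `n×m` matrices `X` (mod `ℤ^{nm}`) such that
`qX ∈ B(0,r) + P(q)`, where `P(q)` is the lift of `P(gcd q)` and balls are max-norm. -/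
def approxSet (m n : ℕ) (P : ℕ → Finset (Fin m → ℝ)) (q : Fin n → ℕ) (r : ℝ) :
    Set (Fin n → Fin m → AddCircle (1:ℝ)) :=
  {X | ∃ Y : Fin n → Fin m → ℝ, (∀ i j, ((Y i j : ℝ) : AddCircle (1:ℝ)) = X i j) ∧
    ∃ z ∈ liftSet m P (Finset.univ.gcd q), ‖(fun j => ∑ i, (q i : ℝ) * Y i j) - z‖ ≤ r}

/-- The homomorphism `X ↦ qX` from `n×m` matrices over the circle to `m`-vectors. -/
def rowMulHom (m n : ℕ) (q : Fin n → ℕ) :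
    (Fin n → Fin m → AddCircle (1:ℝ)) →+ (Fin m → AddCircle (1:ℝ)) where
  toFun X := fun j => ∑ i, q i • X i j
  map_zero' := by ext; simp
  map_add' X Y := by ext; simp [Finset.sum_add_distrib]

theorem rowMulHom_apply (m n : ℕ) (q : Fin n → ℕ) (X : Fin n → Fin m → AddCircle (1:ℝ))
    (j : Fin m) : rowMulHom m n q X j = ∑ i, q i • X i j := rfl

theorem rowMulHom_coe (m n : ℕ) (q : Fin n → ℕ) (Y : Fin n → Fin m → ℝ) (j : Fin m) :
    rowMulHom m n q (fun i j => (Y i j : AddCircle (1:ℝ))) j =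
      ((∑ i, (q i : ℝ) * Y i j : ℝ) : AddCircle (1:ℝ)) := by
  rw [rowMulHom_apply, ← QuotientAddGroup.mk'_apply, map_sum]
  refine Finset.sum_congr rfl fun i _ => ?_
  rw [← nsmul_eq_mul, map_nsmul]
  rfl

theorem continuous_rowMulHom (m n : ℕ) (q : Fin n → ℕ) : Continuous (rowMulHom m n q) := by
  refine continuous_pi fun j => ?_
  simp only [rowMulHom_apply]
  fun_prop

theorem rowMulHom_surjective (m n : ℕ) {q : Fin n → ℕ} (hq : q ≠ 0) :
    Function.Surjective (rowMulHom m n q) := by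
  obtain ⟨i₀, hi₀⟩ := Function.ne_iff.mp hq
  have hi : (q i₀ : ℝ) ≠ 0 := by exact_mod_cast hi₀
  intro y
  choose w hw using fun j => QuotientAddGroup.mk_surjective (y j)
  refine ⟨fun i j => ((if i = i₀ then w j / q i₀ else 0 : ℝ) : AddCircle (1:ℝ)), ?_⟩
  ext j
  rw [rowMulHom_coe, ← hw j]
  simp only [mul_ite, mul_zero, Finset.sum_ite_eq', Finset.mem_univ, if_true]
  rw [mul_div_cancel₀ _ hi]

theorem measurePreserving_rowMulHom (m n : ℕ) {q : Fin n → ℕ} (hq : q ≠ 0) :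
    MeasurePreserving (rowMulHom m n q) volume volume := by
  have : (volume : Measure (Fin m → AddCircle (1:ℝ))).IsAddHaarMeasure :=
    inferInstanceAs (Measure.pi fun _ => volume).IsAddHaarMeasure
  have : (volume : Measure (Fin n → Fin m → AddCircle (1:ℝ))).IsAddHaarMeasure :=
    Measure.pi.isAddHaarMeasure fun _ => volume
  refine AddMonoidHom.measurePreserving (continuous_rowMulHom m n q)
    (rowMulHom_surjective m n hq) ?_
  simp [volume_pi, Measure.pi_univ]

/-- The distance in the circle between the classes of two reals is attained by some integer
translate. -/
theorem exists_int_norm_coe_eq (x : ℝ) :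
    ∃ k : ℤ, ‖(x : AddCircle (1:ℝ))‖ = |x - k| :=
  ⟨round x, UnitAddCircle.norm_eq⟩

theorem norm_coe_le_abs_sub_int (x : ℝ) (k : ℤ) : ‖(x : AddCircle (1:ℝ))‖ ≤ |x - k| := by
  rw [UnitAddCircle.norm_eq]
  exact round_le x k

/-- The class in the torus of the rescaled vector `p / d`. -/
noncomputable def scaledClass (m d : ℕ) (p : Fin m → ℝ) : Fin m → AddCircle (1:ℝ) :=
  fun j => ((p j / d : ℝ) : AddCircle (1:ℝ))

theorem approxSet_eq_preimage (m n : ℕ) (P : ℕ → Finset (Fin m → ℝ)) (q q' : Fin n → ℕ)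
    (hd : 0 < Finset.univ.gcd q) (hq' : ∀ i, q i = Finset.univ.gcd q * q' i) {r : ℝ}
    (hr0 : 0 ≤ r) :
    approxSet m n P q r = rowMulHom m n q' ⁻¹'
      ⋃ p ∈ P (Finset.univ.gcd q),
        Metric.closedBall (scaledClass m (Finset.univ.gcd q) p)
          (r / (Finset.univ.gcd q : ℕ)) := by
  unfold approxSet liftSet
  set d := Finset.univ.gcd q
  have hd' : (0:ℝ) < d := by exact_mod_cast hd
  have key : ∀ (Y : Fin n → Fin m → ℝ) (p : Fin m → ℝ) (k : Fin m → ℤ) (j : Fin m),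
      (∑ i, (q i : ℝ) * Y i j) - (p j + d * k j) =
        d * ((∑ i, (q' i : ℝ) * Y i j) - p j / d - k j) := by
    intro Y p k j
    simp only [hq', Nat.cast_mul, mul_assoc, ← Finset.mul_sum]
    field_simp
    ring
  have hball : ∀ (Y : Fin n → Fin m → ℝ) (p : Fin m → ℝ),
      rowMulHom m n q' (fun i j => (Y i j : AddCircle (1:ℝ))) ∈
        Metric.closedBall (scaledClass m d p) (r / d) ↔
      ∀ j, ‖(((∑ i, (q' i : ℝ) * Y i j) - p j / d : ℝ) : AddCircle (1:ℝ))‖ ≤ r / d := by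
    intro Y p
    rw [Metric.mem_closedBall, dist_pi_le_iff (by positivity)]
    refine forall_congr' fun j => ?_
    rw [rowMulHom_coe, dist_eq_norm]
    rfl
  ext X
  simp only [Set.mem_ofPred_eq, Set.mem_preimage, Set.mem_iUnion, exists_prop]
  constructor
  · rintro ⟨Y, hY, z, ⟨p, hp, k, rfl⟩, hz⟩
    obtain rfl : (fun i j => (Y i j : AddCircle (1:ℝ))) = X := by ext i j; exact hY i j
    refine ⟨p, hp, (hball Y p).2 fun j => (norm_coe_le_abs_sub_int _ (k j)).trans ?_⟩
    have h := (pi_norm_le_iff_of_nonneg hr0).1 hz j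
    simp only [Pi.sub_apply, Pi.add_apply, Pi.smul_apply, smul_eq_mul, key, Real.norm_eq_abs,
      abs_mul, abs_of_pos hd'] at h
    rwa [le_div_iff₀' hd']
  · rintro ⟨p, hp, h⟩
    choose Y hY using fun i j => QuotientAddGroup.mk_surjective (X i j)
    obtain rfl : (fun i j => (Y i j : AddCircle (1:ℝ))) = X := by ext i j; exact hY i j
    choose k hk using fun j => exists_int_norm_coe_eq ((∑ i, (q' i : ℝ) * Y i j) - p j / d)
    refine ⟨Y, fun _ _ => rfl, _, ⟨p, hp, k, rfl⟩, (pi_norm_le_iff_of_nonneg hr0).2 fun j => ?_⟩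
    simp only [Pi.sub_apply, Pi.add_apply, Pi.smul_apply, smul_eq_mul, key, Real.norm_eq_abs,
      abs_mul, abs_of_pos hd']
    rw [← le_div_iff₀' hd', ← hk]
    exact (hball Y p).1 h j

theorem closedBall_ae_eq_ball_torus (m : ℕ) (hm : 1 ≤ m) (x : Fin m → AddCircle (1:ℝ)) (ε : ℝ) :
    Metric.closedBall x ε =ᵐ[volume] Metric.ball x ε := by
  have : Nonempty (Fin m) := ⟨⟨0, hm⟩⟩
  rw [closedBall_pi', ball_pi']
  exact Measure.ae_eq_set_pi fun _ _ => AddCircle.closedBall_ae_eq_ball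

theorem volume_closedBall_torus (m : ℕ) (x : Fin m → AddCircle (1:ℝ)) {ε : ℝ} (hε : 0 ≤ ε)
    (hε' : 2 * ε ≤ 1) :
    volume (Metric.closedBall x ε) = ENNReal.ofReal (2 * ε) ^ m := by
  rw [closedBall_pi _ hε, volume_pi, Measure.pi_pi]
  simp [AddCircle.volume_closedBall, min_eq_right hε']

/-- Distinct points of a separated set of representatives have separated classes. -/
theorem le_dist_scaledClass (m : ℕ) (P : ℕ → Finset (Fin m → ℝ)) {d : ℕ} (hd : 0 < d)
    (hrep : ∀ p ∈ P d, ∀ j, (0:ℝ) ≤ p j ∧ p j < d) {r : ℝ}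
    (hsep : ∀ x ∈ liftSet m P d, ∀ y ∈ liftSet m P d, x ≠ y → 2 * r ≤ ‖x - y‖)
    {p p' : Fin m → ℝ} (hp : p ∈ P d) (hp' : p' ∈ P d) (hne : p ≠ p') :
    r / d + r / d ≤ dist (scaledClass m d p) (scaledClass m d p') := by
  have hd' : (0:ℝ) < d := by exact_mod_cast hd
  choose k hk using fun j => exists_int_norm_coe_eq (p j / d - p' j / d)
  have hne' : p ≠ p' + (d : ℝ) • fun j => ((k j : ℤ) : ℝ) := by
    intro h
    refine hne (funext fun j => ?_)
    have hj : p j = p' j + d * k j := congrFun h j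
    obtain ⟨h1, h2⟩ := hrep p hp j
    obtain ⟨h3, h4⟩ := hrep p' hp' j
    have hk0 : k j = 0 := by
      have hlt : (k j : ℝ) < 1 := by nlinarith
      have hgt : (-1 : ℝ) < k j := by nlinarith
      have hlt' : k j < 1 := by exact_mod_cast hlt
      have hgt' : -1 < k j := by exact_mod_cast hgt
      omega
    simpa [hk0] using hj
  have h := hsep p ⟨p, hp, 0, by ext; simp⟩ _ ⟨p', hp', k, rfl⟩ hne'
  rw [← add_div, ← two_mul, div_le_iff₀' hd']
  refine h.trans ((pi_norm_le_iff_of_nonneg (by positivity)).2 fun j => ?_)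
  have hj : (p - (p' + (d : ℝ) • fun j => ((k j : ℤ) : ℝ))) j =
      d * (p j / d - p' j / d - k j) := by
    simp only [Pi.sub_apply, Pi.add_apply, Pi.smul_apply, smul_eq_mul]
    field_simp
    ring
  rw [hj, Real.norm_eq_abs, abs_mul, abs_of_pos hd', ← hk]
  refine mul_le_mul_of_nonneg_left ?_ hd'.le
  refine le_trans (le_of_eq ?_) (dist_le_pi_dist _ _ j)
  rw [dist_eq_norm]
  rfl

theorem two_mul_le_of_separated (m : ℕ) (hm : 1 ≤ m) (P : ℕ → Finset (Fin m → ℝ)) {d : ℕ}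
    (hd : 0 < d) {r : ℝ}
    (hsep : ∀ x ∈ liftSet m P d, ∀ y ∈ liftSet m P d, x ≠ y → 2 * r ≤ ‖x - y‖)
    {p : Fin m → ℝ} (hp : p ∈ P d) : 2 * r ≤ d := by
  have : Nonempty (Fin m) := ⟨⟨0, hm⟩⟩
  have hd' : (0:ℝ) < d := by exact_mod_cast hd
  have h := hsep (p + (d : ℝ) • fun _ => ((1 : ℤ) : ℝ)) ⟨p, hp, fun _ => 1, rfl⟩
    p ⟨p, hp, 0, by ext; simp⟩ (fun h => by
      have hj := congrFun h ⟨0, hm⟩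
      simp at hj
      omega)
  refine h.trans ((pi_norm_le_iff_of_nonneg hd'.le).2 fun j => ?_)
  simp

/-- **Measure of an approximation set.** If the points of the lifted set `P(q)` are pairwise
at distance at least `2r`, then `Leb(A_{n,m}^P(q,r)) = #P(gcd q) · (2r/gcd q)^m`. -/
theorem approxSet_volume (m n : ℕ) (hm : 1 ≤ m) (hn : 1 ≤ n)
    (P : ℕ → Finset (Fin m → ℝ))
    (hrep : ∀ d : ℕ, 1 ≤ d → ∀ p ∈ P d, ∀ j, (0:ℝ) ≤ p j ∧ p j < d)
    (q : Fin n → ℕ) (hq : q ≠ 0) (r : ℝ) (hr0 : 0 ≤ r)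
    (hsep : ∀ x ∈ liftSet m P (Finset.univ.gcd q), ∀ y ∈ liftSet m P (Finset.univ.gcd q),
      x ≠ y → 2 * r ≤ ‖x - y‖) :
    volume (approxSet m n P q r)
      = ((P (Finset.univ.gcd q)).card : ℝ≥0∞) *
        ENNReal.ofReal (2 * r / ((Finset.univ.gcd q : ℕ) : ℝ)) ^ m := by
  have hd : 0 < Finset.univ.gcd q := by
    refine Nat.pos_of_ne_zero fun h => hq (funext fun i => ?_)
    exact Finset.gcd_eq_zero_iff.1 h i (Finset.mem_univ i)
  have hd' : (0:ℝ) < (Finset.univ.gcd q : ℕ) := by exact_mod_cast hd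
  choose q' hq' using fun i => Finset.gcd_dvd (f := q) (Finset.mem_univ i)
  have hq'0 : q' ≠ 0 := by
    rintro rfl
    exact hq (funext fun i => by simpa using hq' i)
  rw [approxSet_eq_preimage m n P q q' hd hq' hr0,
    (measurePreserving_rowMulHom m n hq'0).measure_preimage
      (Finset.measurableSet_biUnion _ fun _ _ =>
        Metric.isClosed_closedBall.measurableSet).nullMeasurableSet,
    measure_biUnion_finset₀ ?_ fun _ _ =>
      Metric.isClosed_closedBall.measurableSet.nullMeasurableSet]
  · rw [Finset.sum_congr rfl fun p hp => volume_closedBall_torus m _ (by positivity) (?_),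
      Finset.sum_const, nsmul_eq_mul, mul_div_assoc]
    rw [← mul_div_assoc, div_le_one hd']
    exact two_mul_le_of_separated m hm P hd hsep hp
  · intro p hp p' hp' hne
    refine AEDisjoint.congr (Disjoint.aedisjoint (Metric.ball_disjoint_ball
      (le_dist_scaledClass m P hd (hrep _ hd) hsep hp hp' hne)))
      (closedBall_ae_eq_ball_torus m hm _ _) (closedBall_ae_eq_ball_torus m hm _ _)
end

section
/- Let m, n ≥ 1, let P(d) ⊂ (ℝ/dℤ)^m be finite nonempty sets lifted as usual, and let ψ : ℤ₊^n → ℝ₊. Suppose there exist d, Q ≥ 1 such that Ψ_Q(d) = (Σ_{gcd(q)=d, |q/gcd(q)|≥Q} ψ(q)^m)^{1/m} = ∞. Then Leb(W_{n,m}^P(ψ)) = 1, where W_{n,m}^P(ψ) ⊆ 𝕋^{nm} is the set of X for which qX ∈ B(0,ψ(q)) + P(q) for infinitely many q ∈ ℤ₊^n. -/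
open MeasureTheory
open scoped ENNReal

/-- `W_{n,m}^P(ψ) ⊆ 𝕋^{nm}`: matrices `X` satisfying `qX ∈ B(0,ψ(q)) + P(q)` for
infinitely many `q ∈ ℤ₊^n`. -/
def limsupSet (m n : ℕ) (P : ℕ → Finset (Fin m → ℝ)) (ψ : (Fin n → ℕ) → ℝ) :
    Set (Fin n → Fin m → AddCircle (1:ℝ)) :=
  {X | {v : Fin n → ℕ | v ≠ 0 ∧ X ∈ approxSet m n P v (ψ v)}.Infinite}

open ProbabilityTheory Set

/-- **Second Borel–Cantelli lemma for pairwise independent events**: if the measures of pairwise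
independent events have infinite sum, almost every point lies in infinitely many of them. -/
theorem ae_infinite_of_pairwise_indepSet {Ω ι : Type*} [MeasurableSpace Ω] {μ : Measure Ω}
    [IsProbabilityMeasure μ] {E : ι → Set Ω} (hE : ∀ i, MeasurableSet (E i))
    (hind : Pairwise fun i j => IndepSet (E i) (E j) μ) (hsum : ∑' i, μ (E i) = ⊤) :
    ∀ᵐ ω ∂μ, {i | ω ∈ E i}.Infinite := by
  set X : ι → Ω → ℝ := fun i => (E i).indicator fun _ => 1 with hX
  have hXmem : ∀ i, MemLp (X i) 2 μ := fun i =>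
    memLp_indicator_const 2 (hE i) 1 (Or.inr (measure_ne_top _ _))
  have hXint : ∀ i, μ[X i] = μ.real (E i) := fun i => by
    simp [hX, integral_indicator_const _ (hE i)]
  have hXvar : ∀ i, variance (X i) μ ≤ μ.real (E i) := fun i => by
    refine (variance_le_expectation_sq (hXmem i).1).trans (le_of_eq ?_)
    rw [← hXint i]
    congr 1
    ext ω
    by_cases h : ω ∈ E i <;> simp [hX, h]
  have hXind : Pairwise fun i j => IndepFun (X i) (X j) μ := fun i j hij => by
    have h : Indep (MeasurableSpace.generateFrom {E i}) ((inferInstance : MeasurableSpace ℝ).comap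
        (X j)) μ := by
      refine indep_of_indep_of_le_right (hind hij) ?_
      refine Measurable.comap_le ?_
      exact (measurable_const (a := (1 : ℝ))).indicator
        (MeasurableSpace.measurableSet_generateFrom (mem_singleton _))
    exact h.indicator_indepFun 1 (MeasurableSpace.measurableSet_generateFrom (mem_singleton _))
  have key : ∀ M : ℕ, μ {ω | {i | ω ∈ E i}.Finite ∧ {i | ω ∈ E i}.ncard ≤ M} = 0 := by
    intro M
    refine le_antisymm (ENNReal.le_of_forall_pos_le_add fun ε hε _ => ?_) zero_le
    obtain ⟨s, hs⟩ : ∃ s : Finset ι, 2 * M + 4 / (ε : ℝ) + 1 ≤ ∑ i ∈ s, μ.real (E i) := by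
      have h1 : ENNReal.ofReal (2 * M + 4 / (ε : ℝ) + 1) < ∑' i, μ (E i) := by
        rw [hsum]; exact ENNReal.ofReal_lt_top
      rw [ENNReal.tsum_eq_iSup_sum, lt_iSup_iff] at h1
      obtain ⟨s, hs⟩ := h1
      refine ⟨s, ?_⟩
      have h2 : ∑ i ∈ s, μ (E i) = ENNReal.ofReal (∑ i ∈ s, μ.real (E i)) := by
        rw [ENNReal.ofReal_sum_of_nonneg fun _ _ => measureReal_nonneg]
        simp
      rw [h2] at hs
      exact (ENNReal.ofReal_le_ofReal_iff (Finset.sum_nonneg fun _ _ => measureReal_nonneg)).1 hs.le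
    set e := ∑ i ∈ s, μ.real (E i) with he
    have hε' : (0 : ℝ) < ε := hε
    have h4 : 0 < 4 / (ε : ℝ) := by positivity
    have hM : (0 : ℝ) ≤ M := Nat.cast_nonneg M
    have hepos : 0 < e := by linarith
    have hint : μ[∑ i ∈ s, X i] = e := by
      simp only [Finset.sum_apply]
      rw [integral_finsetSum _ fun i _ => (hXmem i).integrable one_le_two]
      exact Finset.sum_congr rfl fun i _ => hXint i
    have hvar : variance (∑ i ∈ s, X i) μ ≤ e := by
      rw [IndepFun.variance_sum (fun i _ => hXmem i) fun i _ j _ hij => hXind hij]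
      exact Finset.sum_le_sum fun i _ => hXvar i
    have hcheb := meas_ge_le_variance_div_sq (memLp_finsetSum' s fun i _ => hXmem i)
      (half_pos hepos) (μ := μ)
    rw [hint] at hcheb
    refine (measure_mono ?_).trans (hcheb.trans ?_)
    · rintro ω ⟨hfin, hcard⟩
      have hle : (∑ i ∈ s, X i) ω ≤ M := by
        classical
        have h1 : (∑ i ∈ s, X i) ω = ((s.filter fun i => ω ∈ E i).card : ℝ) := by
          simp [hX, Finset.sum_apply, indicator_apply]
        rw [h1]
        norm_cast
        refine le_trans ?_ hcard
        rw [← ncard_coe_finset]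
        exact ncard_le_ncard (fun i hi => by simpa using (Finset.mem_filter.1 hi).2) hfin
      change e / 2 ≤ |(∑ i ∈ s, X i) ω - e|
      rw [abs_sub_comm]
      exact le_trans (by linarith) (le_abs_self _)
    · rw [zero_add, ENNReal.ofReal_le_iff_le_toReal ENNReal.coe_ne_top, ENNReal.coe_toReal]
      rw [div_le_iff₀ (by positivity)]
      have h5 : 4 / (ε : ℝ) ≤ e := by linarith
      rw [div_le_iff₀ hε'] at h5
      nlinarith
  have h0 : μ (⋃ M : ℕ, {ω | {i | ω ∈ E i}.Finite ∧ {i | ω ∈ E i}.ncard ≤ M}) = 0 :=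
    measure_iUnion_null key
  refine measure_mono_null (fun ω hω => ?_) h0
  have hfin : {i | ω ∈ E i}.Finite := not_infinite.1 hω
  exact mem_iUnion.2 ⟨_, hfin, le_rfl⟩

theorem ENNReal.tsum_min_one_eq_top {ι : Type*} {a : ι → ℝ≥0∞} (ha : ∀ i, a i ≠ ⊤)
    (hsum : ∑' i, a i = ⊤) : ∑' i, min 1 (a i) = ⊤ := by
  by_contra h
  have hfin := ENNReal.finite_const_le_of_tsum_ne_top h one_ne_zero
  set s := hfin.toFinset with hs
  have hle : ∀ i, a i ≤ min 1 (a i) + (s : Set ι).indicator a i := by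
    intro i
    by_cases hi : 1 ≤ a i
    · have : i ∈ (s : Set ι) := by simp [hs, hi]
      rw [indicator_of_mem this]
      exact le_add_self
    · rw [min_eq_right (not_le.1 hi).le]
      exact le_self_add
  have h1 := ENNReal.tsum_le_tsum hle
  rw [hsum, ENNReal.tsum_add, top_le_iff, ENNReal.add_eq_top] at h1
  refine h1.elim h fun h2 => ?_
  rw [tsum_eq_sum (s := s) fun i hi => indicator_of_notMem (by simpa using hi) _] at h2
  obtain ⟨i, hi, h3⟩ := ENNReal.sum_eq_top.1 h2
  rw [indicator_of_mem (by simpa using hi)] at h3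
  exact ha i h3

/-- The integer linear combination `X ↦ ∑ i, q i • X i`, as a homomorphism. -/
def linearComb {n : ℕ} (V : Type*) [AddCommGroup V] (q : Fin n → ℕ) : (Fin n → V) →+ V where
  toFun X := ∑ i, q i • X i
  map_zero' := by simp
  map_add' X Y := by simp [Finset.sum_add_distrib]

section linearComb

variable {n : ℕ} {V : Type*} [AddCommGroup V]

theorem linearComb_apply (q : Fin n → ℕ) (X : Fin n → V) : linearComb V q X = ∑ i, q i • X i :=
  rfl

theorem linearComb_single (q : Fin n → ℕ) (i : Fin n) (x : V) :
    linearComb V q (Pi.single i x) = (q i : ℤ) • x := by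
  rw [linearComb_apply, Finset.sum_eq_single i (fun j _ hj => by simp [Pi.single_eq_of_ne hj])
    (by simp)]
  simp

theorem continuous_linearComb [TopologicalSpace V] [IsTopologicalAddGroup V] (q : Fin n → ℕ) :
    Continuous (linearComb V q) :=
  continuous_finsetSum Finset.univ fun i _ => (continuous_apply i).fun_const_smul (q i)

variable [DivisibleBy V ℤ]

theorem linearComb_surjective {q : Fin n → ℕ} (hq : q ≠ 0) :
    Function.Surjective (linearComb V q) := by
  intro a
  obtain ⟨i, hi⟩ := Function.ne_iff.1 hq
  refine ⟨Pi.single i (DivisibleBy.div a (q i : ℤ)), ?_⟩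
  rw [linearComb_single]
  exact DivisibleBy.div_cancel a (Nat.cast_ne_zero.2 hi)

theorem linearComb_prod_surjective {q r : Fin n → ℕ} {i j : Fin n}
    (h : q i * r j ≠ q j * r i) :
    Function.Surjective ((linearComb V q).prod (linearComb V r)) := by
  rintro ⟨a, b⟩
  set D : ℤ := q i * r j - q j * r i with hD
  have hD0 : D ≠ 0 := sub_ne_zero.2 (by exact_mod_cast h)
  refine ⟨Pi.single i ((r j : ℤ) • DivisibleBy.div a D - (q j : ℤ) • DivisibleBy.div b D) +
    Pi.single j ((q i : ℤ) • DivisibleBy.div b D - (r i : ℤ) • DivisibleBy.div a D), ?_⟩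
  rw [AddMonoidHom.prod_apply, map_add, map_add]
  simp only [linearComb_single]
  refine Prod.ext ?_ ?_
  · conv_rhs => rw [← DivisibleBy.div_cancel a hD0]
    simp only [hD]; module
  · conv_rhs => rw [← DivisibleBy.div_cancel b hD0]
    simp only [hD]; module

variable [TopologicalSpace V] [IsTopologicalAddGroup V] [CompactSpace V]
  [SecondCountableTopology V] [MeasureSpace V] [BorelSpace V]
  [Measure.IsAddHaarMeasure (volume : Measure V)] [IsProbabilityMeasure (volume : Measure V)]

theorem measurePreserving_linearComb {q : Fin n → ℕ} (hq : q ≠ 0) :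
    MeasurePreserving (linearComb V q) :=
  AddMonoidHom.measurePreserving (continuous_linearComb q) (linearComb_surjective hq)
    (by simp only [measure_univ])

theorem indepFun_linearComb {q r : Fin n → ℕ} (hq : q ≠ 0) (hr : r ≠ 0) {i j : Fin n}
    (h : q i * r j ≠ q j * r i) :
    IndepFun (linearComb V q) (linearComb V r) volume := by
  have hp : MeasurePreserving ((linearComb V q).prod (linearComb V r)) volume
      ((volume : Measure V).prod volume) :=
    AddMonoidHom.measurePreserving ((continuous_linearComb q).prodMk (continuous_linearComb r))
      (linearComb_prod_surjective h) (by simp only [measure_univ])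
  rw [indepFun_iff_map_prod_eq_prod_map_map (continuous_linearComb q).aemeasurable
    (continuous_linearComb r).aemeasurable, (measurePreserving_linearComb hq).map_eq,
    (measurePreserving_linearComb hr).map_eq]
  exact hp.map_eq

end linearComb

instance AddCircle.isProbabilityMeasure_volume_one :
    IsProbabilityMeasure (volume : Measure (AddCircle (1 : ℝ))) :=
  ⟨by rw [AddCircle.measure_univ, ENNReal.ofReal_one]⟩

theorem UnitAddTorus.volume_closedBall {m : ℕ} (x : Fin m → AddCircle (1 : ℝ)) {ε : ℝ}
    (hε : 0 ≤ ε) :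
    volume (Metric.closedBall x ε) = min 1 (ENNReal.ofReal ((2 * ε) ^ m)) := by
  rw [volume_pi_closedBall x hε]
  simp only [AddCircle.volume_closedBall, Finset.prod_const, Finset.card_univ, Fintype.card_fin]
  rw [ENNReal.ofReal_pow (by positivity)]
  rcases le_total 1 (2 * ε) with h | h
  · rw [min_eq_left h, ENNReal.ofReal_one, one_pow, min_eq_left]
    exact one_le_pow₀ (ENNReal.one_le_ofReal.2 h)
  · rw [min_eq_right h, min_eq_right]
    exact pow_le_one₀ zero_le (ENNReal.ofReal_le_one.2 h)

theorem Finset.exists_mul_ne_mul_of_gcd_eq {n : ℕ} {v w : Fin n → ℕ}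
    (hgcd : univ.gcd v = univ.gcd w) (hv : v ≠ 0) (hvw : v ≠ w) :
    ∃ i j, v i * w j ≠ v j * w i := by
  by_contra! h
  refine hvw (funext fun i => ?_)
  have h1 : univ.gcd (fun j => v i * w j) = univ.gcd (fun j => w i * v j) :=
    congrArg _ (funext fun j => by rw [h i j, mul_comm])
  rw [Finset.gcd_mul_left, Finset.gcd_mul_left, ← hgcd] at h1
  refine Nat.eq_of_mul_eq_mul_right (Nat.pos_of_ne_zero fun h0 => hv ?_) (by simpa using h1)
  exact funext fun k => Finset.gcd_eq_zero_iff.1 h0 k (Finset.mem_univ k)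

theorem mem_approxSet_of_linearComb_mem_closedBall {m n : ℕ} {P : ℕ → Finset (Fin m → ℝ)} {d : ℕ}
    (hd : 0 < d) {p : Fin m → ℝ} (hp : p ∈ P d) {v u : Fin n → ℕ} (hv : Finset.univ.gcd v = d)
    (hu : ∀ i, v i = d * u i) {r : ℝ} {X : Fin n → Fin m → AddCircle (1 : ℝ)}
    (hX : linearComb _ u X ∈
      Metric.closedBall (fun j => ((p j / d : ℝ) : AddCircle (1 : ℝ))) (r / d)) :
    X ∈ approxSet m n P v r := by
  have hd' : (0 : ℝ) < d := Nat.cast_pos.2 hd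
  have hr : 0 ≤ r := by
    have := dist_nonneg.trans (Metric.mem_closedBall.1 hX)
    rwa [le_div_iff₀ hd', zero_mul] at this
  choose Y hY using fun i j => QuotientAddGroup.mk_surjective (X i j)
  set c : Fin m → ℝ := fun j => ∑ i, (u i : ℝ) * Y i j - p j / d with hc
  refine ⟨Y, hY, fun j => p j + d * (round (c j) : ℤ), ?_, ?_⟩
  · rw [hv]
    exact ⟨p, hp, fun j => round (c j), rfl⟩
  · refine (pi_norm_le_iff_of_nonneg hr).2 fun j => ?_
    have h1 : |c j - round (c j)| ≤ r / d := by
      rw [← UnitAddCircle.norm_eq]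
      have h2 := (dist_le_pi_dist _ _ j).trans (Metric.mem_closedBall.1 hX)
      rw [dist_eq_norm] at h2
      refine (congrArg (norm : AddCircle (1 : ℝ) → ℝ) ?_).trans_le h2
      rw [linearComb_apply, Finset.sum_apply, hc]
      refine (AddCircle.coe_sub _ _ _).trans (congrArg (· - _) ?_)
      rw [← QuotientAddGroup.mk'_apply, map_sum]
      refine Finset.sum_congr rfl fun i _ => ?_
      rw [Pi.smul_apply, ← hY i j, ← nsmul_eq_mul]
      rfl
    have h3 : ∑ i, (v i : ℝ) * Y i j - (p j + d * (round (c j) : ℤ)) =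
        d * (c j - round (c j)) := by
      have h4 : ∑ i, (v i : ℝ) * Y i j = d * ∑ i, (u i : ℝ) * Y i j := by
        rw [Finset.mul_sum]
        exact Finset.sum_congr rfl fun i _ => by rw [hu i]; push_cast; ring
      rw [h4, hc]
      field_simp
      ring
    change |∑ i, (v i : ℝ) * Y i j - (p j + d * (round (c j) : ℤ))| ≤ r
    rw [h3, abs_mul, abs_of_pos hd']
    rwa [le_div_iff₀ hd', mul_comm] at h1

/-- **If some `Ψ_Q(d) = ∞` then `W_{n,m}^P(ψ)` has full measure.** -/
theorem full_measure_of_PsiQ_infinite (m n : ℕ) (hm : 1 ≤ m) (hn : 1 ≤ n)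
    (P : ℕ → Finset (Fin m → ℝ))
    (hrep : ∀ d : ℕ, 1 ≤ d → ∀ p ∈ P d, ∀ j, (0:ℝ) ≤ p j ∧ p j < d)
    (hne : ∀ d : ℕ, 1 ≤ d → (P d).Nonempty)
    (ψ : (Fin n → ℕ) → ℝ) (hψ0 : ∀ v, 0 ≤ ψ v)
    (hinf : ∃ d Q : ℕ, 1 ≤ d ∧ 1 ≤ Q ∧
      ∑' v : {v : Fin n → ℕ // v ≠ 0 ∧ Finset.univ.gcd v = d ∧
          Q * Finset.univ.gcd v ≤ Finset.univ.sup v},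
        ENNReal.ofReal (ψ v.1 ^ m) = ⊤) :
    volume (limsupSet m n P ψ) = 1 := by
  obtain ⟨d, Q, hd, -, hsum⟩ := hinf
  have hd' : (0 : ℝ) < d := by exact_mod_cast hd
  obtain ⟨p, hp⟩ := hne d hd
  let ι := {v : Fin n → ℕ // v ≠ 0 ∧ Finset.univ.gcd v = d ∧
    Q * Finset.univ.gcd v ≤ Finset.univ.sup v}
  have hdvd : ∀ (v : ι) (i : Fin n), ∃ k, v.1 i = d * k := fun v i => by
    have := Finset.gcd_dvd (f := v.1) (Finset.mem_univ i)
    rwa [v.2.2.1] at this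
  choose u hu using hdvd
  have hu0 : ∀ v, u v ≠ 0 := fun v h =>
    v.2.1 (funext fun i => by rw [hu v i, h]; simp)
  let c : Fin m → AddCircle (1 : ℝ) := fun j => ((p j / d : ℝ) : AddCircle (1 : ℝ))
  let B : ι → Set (Fin m → AddCircle (1 : ℝ)) := fun v => Metric.closedBall c (ψ v.1 / d)
  have hB : ∀ v, MeasurableSet (B v) := fun v => Metric.isClosed_closedBall.measurableSet
  let E : ι → Set (Fin n → Fin m → AddCircle (1 : ℝ)) := fun v => linearComb _ (u v) ⁻¹' B v
  have hE : ∀ v, MeasurableSet (E v) := fun v =>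
    (continuous_linearComb (u v)).measurable (hB v)
  have hind : Pairwise fun v w => IndepSet (E v) (E w) volume := by
    intro v w hvw
    obtain ⟨i, j, hij⟩ := Finset.exists_mul_ne_mul_of_gcd_eq
      (v.2.2.1.trans w.2.2.1.symm) v.2.1 (fun h => hvw (Subtype.ext h))
    have hij' : u v i * u w j ≠ u v j * u w i := fun h => hij <| by
      rw [hu, hu, hu, hu, mul_mul_mul_comm, h, mul_mul_mul_comm]
    have h := indepFun_linearComb (V := Fin m → AddCircle (1 : ℝ)) (hu0 v) (hu0 w) hij'
    refine (indepSet_iff_measure_inter_eq_mul (hE v) (hE w) volume).2 ?_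
    exact h.measure_inter_preimage_eq_mul _ _ (hB v) (hB w)
  have hvol : ∀ v, volume (E v) = min 1 (ENNReal.ofReal ((2 * (ψ v.1 / d)) ^ m)) := fun v => by
    rw [← UnitAddTorus.volume_closedBall c (div_nonneg (hψ0 _) hd'.le)]
    exact (measurePreserving_linearComb (hu0 v)).measure_preimage (hB v).nullMeasurableSet
  have hdiv : ∑' v, volume (E v) = ⊤ := by
    simp only [hvol]
    refine ENNReal.tsum_min_one_eq_top (fun _ => ENNReal.ofReal_ne_top) ?_
    have hscale : ∀ v : ι, ENNReal.ofReal ((2 * (ψ v.1 / d)) ^ m) =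
        ENNReal.ofReal ((2 / d) ^ m) * ENNReal.ofReal (ψ v.1 ^ m) := fun v => by
      rw [← ENNReal.ofReal_mul (by positivity), ← mul_pow]
      ring_nf
    simp only [hscale]
    rw [ENNReal.tsum_mul_left, hsum, ENNReal.mul_top]
    exact (ENNReal.ofReal_pos.2 (by positivity)).ne'
  have hae : ∀ᵐ X, X ∈ limsupSet m n P ψ := by
    filter_upwards [ae_infinite_of_pairwise_indepSet hE hind hdiv] with X hX
    refine (hX.image Subtype.val_injective.injOn).mono ?_
    rintro _ ⟨v, hv, rfl⟩
    exact ⟨v.2.1, mem_approxSet_of_linearComb_mem_closedBall hd hp v.2.2.1 (hu v) hv⟩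
  exact (measure_congr (Filter.eventuallyEq_univ.2 hae)).trans measure_univ
end

section
/- Fix m, n ≥ 1, let P be relatively well-spread with constants a, c > 0, and let ψ : ℤ₊^n → ℝ₊. If there are infinitely many q ∈ ℤ₊^n for which ψ(q) ≥ (a/2)·gcd(q)/(#P(gcd(q)))^{1/m}, then Leb(W_{n,m}^P(ψ)) ≥ a^m c > 0. If moreover for infinitely many Q ≥ 1 there exists such a q with |q/gcd(q)| ≥ Q, then Leb(W_{n,m}^P(ψ)) = 1. -/
open MeasureTheory Filter
open scoped ENNReal

/-- Reverse Fatou lemma for sets of a finite measure. -/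
lemma le_measure_limsup_of_forall_le {α : Type*} [MeasurableSpace α] {μ : Measure α}
    [IsFiniteMeasure μ] {E : ℕ → Set α} (hE : ∀ k, MeasurableSet (E k)) {δ : ℝ≥0∞}
    (hδ : ∀ k, δ ≤ μ (E k)) : δ ≤ μ (limsup E atTop) := by
  have hlim : limsup E atTop = ⋂ K : ℕ, ⋃ k ≥ K, E k := by
    rw [limsup_eq_iInf_iSup_of_nat]
    simp
  rw [hlim, Antitone.measure_iInter]
  · exact le_iInf fun K => (hδ K).trans (measure_mono (Set.subset_iUnion₂_of_subset K le_rfl subset_rfl))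
  · intro K L hKL
    exact Set.biUnion_subset_biUnion_left fun k (hk : L ≤ k) => hKL.trans hk
  · exact fun K =>
      (MeasurableSet.biUnion (Set.to_countable _) fun k _ => hE k).nullMeasurableSet
  · exact ⟨0, measure_ne_top _ _⟩

/-- If the measures of the `E k` are bounded below and the periods of `E k` become dense as `k`
grows, then almost every point lies in infinitely many of the `E k`. -/
lemma measure_limsup_eq_one_of_dense_periods {G : Type*} [AddCommGroup G] [TopologicalSpace G]
    [IsTopologicalAddGroup G] [CompactSpace G] [T2Space G] [SecondCountableTopology G]
    [MeasurableSpace G] [BorelSpace G] {μ : Measure G} [μ.IsAddHaarMeasure]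
    [IsProbabilityMeasure μ] {E : ℕ → Set G} (hE : ∀ k, MeasurableSet (E k)) {δ : ℝ≥0∞}
    (hδ0 : δ ≠ 0) (hδ : ∀ k, δ ≤ μ (E k))
    (hdense : ∀ U ∈ nhds (0 : G), ∀ᶠ k in atTop, ∀ t, ∃ s, t - s ∈ U ∧
      ∀ x, s + x ∈ E k ↔ x ∈ E k) :
    μ (limsup E atTop) = 1 := by
  have hlim : (limsup E atTop)ᶜ = ⋃ K : ℕ, ⋂ k ≥ K, (E k)ᶜ := by
    rw [limsup_eq_iInf_iSup_of_nat]
    simp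
  rw [← prob_compl_eq_zero_iff (.measurableSet_limsup hE), hlim, measure_iUnion_null_iff]
  intro K
  set T : Set G := ⋂ k ≥ K, (E k)ᶜ
  by_contra hT0
  have hTm : MeasurableSet T :=
    MeasurableSet.biInter (Set.to_countable _) fun k _ => (hE k).compl
  have hcont : Tendsto (fun u : G => μ (symmDiff ((fun x => u + x) ⁻¹' T) T))
      (nhds 0) (nhds 0) := by
    have h := tendsto_measure_symmDiff_preimage_nhds_zero (μ := μ) (ν := μ) (l := nhds (0 : G))
      (f := fun u => (⟨fun x => u + x, by fun_prop⟩ : C(G, G)))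
      (g := (⟨fun x => 0 + x, by fun_prop⟩ : C(G, G))) (s := T)
      ((ContinuousMap.curry ⟨fun p : G × G => p.1 + p.2, by fun_prop⟩).continuous.tendsto 0)
      (.of_forall fun u => measurePreserving_add_left μ u) (measurePreserving_add_left μ 0)
      hTm.nullMeasurableSet (measure_ne_top _ _)
    simpa using h
  have hε : μ T * δ ≠ 0 := mul_ne_zero hT0 hδ0
  obtain ⟨ε, hε0, hεlt⟩ := exists_between (pos_iff_ne_zero.mpr hε)
  obtain ⟨k, hk, hKk⟩ := ((hdense _ (hcont.eventually (gt_mem_nhds hε0))).and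
    (eventually_ge_atTop K)).exists
  have hsmall : ∀ t : G, μ {x | t + x ∈ T ∧ x ∈ E k} ≤ ε := by
    intro t
    obtain ⟨s, hs, hper⟩ := hk t
    refine le_trans ?_ (le_of_lt hs)
    rw [← measure_preimage_add μ s (symmDiff _ _)]
    refine measure_mono ?_
    rintro x ⟨hxT, hxE⟩
    refine Or.inl ⟨?_, fun h => ?_⟩
    · change t - s + (s + x) ∈ T
      rwa [← add_assoc, sub_add_cancel]
    · exact Set.mem_iInter₂.mp h k hKk ((hper x).mpr hxE)
  have hS : MeasurableSet {p : G × G | p.1 + p.2 ∈ T ∧ p.2 ∈ E k} :=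
    (measurable_fst.add measurable_snd hTm).inter (measurable_snd (hE k))
  have h1 : (μ.prod μ) {p : G × G | p.1 + p.2 ∈ T ∧ p.2 ∈ E k} ≤ ε := by
    rw [Measure.prod_apply hS]
    calc _ ≤ ∫⁻ _ : G, ε ∂μ := lintegral_mono hsmall
      _ = ε := by simp
  have h2 : (μ.prod μ) {p : G × G | p.1 + p.2 ∈ T ∧ p.2 ∈ E k} = μ T * μ (E k) := by
    rw [Measure.prod_apply_symm hS, ← lintegral_indicator_const (hE k)]
    refine lintegral_congr fun x => ?_
    by_cases hx : x ∈ E k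
    · simp only [Set.preimage_ofPred_eq, hx, and_true, Set.indicator_of_mem]
      exact measure_preimage_add_right μ x T
    · simp [hx]
  exact absurd (h2 ▸ h1) (not_le.mpr (hεlt.trans_le (mul_le_mul_right (hδ k) _)))

/-- Instance search does not find the additive Haar property through the nested product. -/
instance isAddHaarMeasure_volume_torusMatrix (n m : ℕ) :
    (volume : Measure (Fin n → Fin m → AddCircle (1:ℝ))).IsAddHaarMeasure :=
  Measure.pi.isAddHaarMeasure _

/-- The homomorphism `X ↦ w X` from `n × m` matrices over the circle to row vectors. -/
def rowCombination {n : ℕ} (m : ℕ) (w : Fin n → ℕ) :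
    (Fin n → Fin m → AddCircle (1:ℝ)) →+ (Fin m → AddCircle (1:ℝ)) where
  toFun X := fun j => ∑ i, w i • X i j
  map_zero' := by ext; simp
  map_add' X Y := by ext; simp [Finset.sum_add_distrib]

lemma continuous_rowCombination {n : ℕ} (m : ℕ) (w : Fin n → ℕ) :
    Continuous (rowCombination m w) := by
  change Continuous fun X : Fin n → Fin m → AddCircle (1:ℝ) => fun j => ∑ i, w i • X i j
  fun_prop

lemma exists_rowCombination_eq_norm_le {n m : ℕ} (w : Fin n → ℕ) (i : Fin n) (hi : w i ≠ 0)
    (y : Fin m → AddCircle (1:ℝ)) :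
    ∃ X, rowCombination m w X = y ∧ ‖X‖ ≤ 1 / (w i : ℝ) := by
  have hlift : ∀ j, ∃ r : ℝ, (r : AddCircle (1:ℝ)) = y j ∧ |r| ≤ 1 := by
    intro j
    obtain ⟨r, hr, hry⟩ := (AddCircle.coe_image_Ico_eq (1:ℝ) 0).symm.subset (Set.mem_univ (y j))
    exact ⟨r, hry, abs_le.mpr ⟨by linarith [hr.1], by linarith [hr.2]⟩⟩
  choose r hr hr1 using hlift
  have hpos : (0:ℝ) < w i := by positivity
  refine ⟨Pi.single i fun j => ((r j / w i : ℝ) : AddCircle (1:ℝ)), ?_, ?_⟩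
  · ext j
    change ∑ i', w i' • (Pi.single i (fun j => ((r j / w i : ℝ) : AddCircle (1:ℝ))) :
      Fin n → Fin m → AddCircle (1:ℝ)) i' j = y j
    rw [Finset.sum_eq_single i]
    · rw [Pi.single_eq_same, ← AddCircle.coe_nsmul, nsmul_eq_mul, mul_div_cancel₀ _ hpos.ne', hr]
    · intro i' _ hne
      simp [hne]
    · simp
  · rw [Pi.norm_single, pi_norm_le_iff_of_nonneg (by positivity)]
    intro j
    refine QuotientAddGroup.norm_mk_le_norm.trans ?_
    rw [Real.norm_eq_abs, abs_div, abs_of_pos hpos]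
    gcongr
    exact hr1 j

lemma measurePreserving_rowCombination {n : ℕ} (m : ℕ) {w : Fin n → ℕ} (hw : w ≠ 0) :
    MeasurePreserving (rowCombination m w) volume volume := by
  obtain ⟨i, hi⟩ := Function.ne_iff.mp hw
  refine AddMonoidHom.measurePreserving (continuous_rowCombination m w) (fun y => ?_) ?_
  · obtain ⟨X, hX, -⟩ := exists_rowCombination_eq_norm_le w i hi y
    exact ⟨X, hX⟩
  · simp [volume_pi, Measure.pi_univ]

/-- The open neighbourhood of relative radius `ρ` of the image of `S / d` in the torus. -/
def torusNhd {m : ℕ} (S : Finset (Fin m → ℝ)) (d : ℕ) (ρ : ℝ) : Set (Fin m → AddCircle (1:ℝ)) :=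
  ⋃ p ∈ S, Metric.ball (fun j => ((p j / d : ℝ) : AddCircle (1:ℝ))) ρ

lemma isOpen_torusNhd {m : ℕ} (S : Finset (Fin m → ℝ)) (d : ℕ) (ρ : ℝ) :
    IsOpen (torusNhd S d ρ) :=
  isOpen_biUnion fun _ _ => Metric.isOpen_ball

lemma volume_ball_torus {m : ℕ} (x : Fin m → AddCircle (1:ℝ)) {ρ : ℝ} (hρ : 0 < ρ)
    (hρ1 : 2 * ρ ≤ 1) : volume (Metric.ball x ρ) = ENNReal.ofReal ((2 * ρ) ^ m) := by
  rw [ball_pi _ hρ, volume_pi_pi]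
  simp_rw [← measure_congr (AddCircle.closedBall_ae_eq_ball (T := 1)),
    AddCircle.volume_closedBall, min_eq_right hρ1]
  rw [Finset.prod_const, Finset.card_univ, Fintype.card_fin, ENNReal.ofReal_pow (by positivity)]

lemma exists_int_norm_sub_lt {m : ℕ} {x y : Fin m → ℝ} {ρ : ℝ}
    (h : dist (fun j => (x j : AddCircle (1:ℝ))) (fun j => (y j : AddCircle (1:ℝ))) < ρ) :
    ∃ k : Fin m → ℤ, ‖x - (y + fun j => (k j : ℝ))‖ < ρ := by
  have hρ : 0 < ρ := dist_nonneg.trans_lt h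
  refine ⟨fun j => round (x j - y j), (pi_norm_lt_iff hρ).mpr fun j => ?_⟩
  have hj := (dist_pi_lt_iff hρ).mp h j
  rw [dist_eq_norm, ← AddCircle.coe_sub, UnitAddCircle.norm_eq] at hj
  simpa [sub_sub, Real.norm_eq_abs] using hj

lemma exists_mem_liftSet_of_mem_torusNhd {m : ℕ} {P : ℕ → Finset (Fin m → ℝ)} {d : ℕ}
    (hd : 1 ≤ d) {ρ : ℝ} {y : Fin m → ℝ}
    (h : (fun j => (y j : AddCircle (1:ℝ))) ∈ torusNhd (P d) d ρ) :
    ∃ z ∈ liftSet m P d, ‖(d : ℝ) • y - z‖ < d * ρ := by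
  obtain ⟨p, hp, hball⟩ := Set.mem_iUnion₂.mp h
  obtain ⟨k, hk⟩ := exists_int_norm_sub_lt hball
  have hd0 : (0:ℝ) < d := by exact_mod_cast hd
  refine ⟨_, ⟨p, hp, k, rfl⟩, ?_⟩
  have : (d : ℝ) • y - (p + (d : ℝ) • fun j => (k j : ℝ)) =
      (d : ℝ) • (y - ((fun j => p j / d) + fun j => (k j : ℝ))) := by
    ext j
    simp only [Pi.sub_apply, Pi.smul_apply, Pi.add_apply, smul_eq_mul]
    field_simp
  rw [this, norm_smul, Real.norm_eq_abs, abs_of_pos hd0]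
  gcongr

lemma rowCombination_preimage_subset_approxSet {m n : ℕ} {P P' : ℕ → Finset (Fin m → ℝ)}
    (hsub : ∀ d, P' d ⊆ P d) {v w : Fin n → ℕ} (hd : 1 ≤ Finset.univ.gcd v)
    (hw : ∀ i, v i = Finset.univ.gcd v * w i) {ρ r : ℝ}
    (hr : (Finset.univ.gcd v : ℕ) * ρ ≤ r) :
    rowCombination m w ⁻¹' torusNhd (P' (Finset.univ.gcd v)) (Finset.univ.gcd v) ρ ⊆
      approxSet m n P v r := by
  intro X hX
  have hlift : ∀ i j, ∃ y : ℝ, (y : AddCircle (1:ℝ)) = X i j := fun i j =>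
    QuotientAddGroup.mk_surjective (X i j)
  choose Y hY using hlift
  have hcoe : rowCombination m w X =
      fun j => ((∑ i, (w i : ℝ) * Y i j : ℝ) : AddCircle (1:ℝ)) := by
    ext j
    change ∑ i, w i • X i j = _
    have := map_sum (QuotientAddGroup.mk' (AddSubgroup.zmultiples (1:ℝ)))
      (fun i => (w i : ℝ) * Y i j) Finset.univ
    refine Eq.trans (Finset.sum_congr rfl fun i _ => ?_) this.symm
    rw [← hY, ← AddCircle.coe_nsmul, nsmul_eq_mul]
    rfl
  rw [Set.mem_preimage, hcoe] at hX
  obtain ⟨z, ⟨p, hp, k, rfl⟩, hz⟩ := exists_mem_liftSet_of_mem_torusNhd hd hX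
  refine ⟨Y, hY, _, ⟨p, hsub _ hp, k, rfl⟩, ?_⟩
  refine le_trans (le_of_eq ?_) (hz.le.trans hr)
  congr 2
  ext j
  simp only [Pi.smul_apply, smul_eq_mul, Finset.mul_sum]
  refine Finset.sum_congr rfl fun i _ => ?_
  conv_lhs => rw [hw i]
  push_cast
  ring

lemma volume_torusNhd {m : ℕ} (hm : 1 ≤ m) {P : ℕ → Finset (Fin m → ℝ)} {d : ℕ} (hd : 1 ≤ d)
    (hrep : ∀ p ∈ P d, ∀ j, (0:ℝ) ≤ p j ∧ p j < d) (hne : (P d).Nonempty) {ρ : ℝ} (hρ : 0 < ρ)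
    (hsep : ∀ x ∈ liftSet m P d, ∀ y ∈ liftSet m P d, x ≠ y → 2 * (d * ρ) ≤ ‖x - y‖) :
    volume (torusNhd (P d) d ρ) = ENNReal.ofReal ((P d).card * (2 * ρ) ^ m) := by
  have hd0 : (0:ℝ) < d := by exact_mod_cast hd
  have hρ1 : 2 * ρ ≤ 1 := by
    obtain ⟨p, hp⟩ := hne
    have : Nonempty (Fin m) := ⟨⟨0, hm⟩⟩
    have hne' : p + (d : ℝ) • (fun _ : Fin m => (((1 : ℤ)) : ℝ)) ≠
        p + (d : ℝ) • (fun _ : Fin m => (((0 : ℤ)) : ℝ)) := by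
      intro h
      have := congrFun h ⟨0, hm⟩
      simp at this
      omega
    have h := hsep _ ⟨p, hp, fun _ => 1, rfl⟩ _ ⟨p, hp, fun _ => 0, rfl⟩ hne'
    rw [add_sub_add_left_eq_sub, ← smul_sub, norm_smul, Real.norm_of_nonneg hd0.le] at h
    have h1 : ‖(fun _ : Fin m => (((1 : ℤ)) : ℝ)) - (fun _ : Fin m => (((0 : ℤ)) : ℝ))‖ = 1 := by
      rw [show ((fun _ : Fin m => (((1 : ℤ)) : ℝ)) - (fun _ : Fin m => (((0 : ℤ)) : ℝ))) =
        fun _ => (1:ℝ) by ext; simp, pi_norm_const, norm_one]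
    rw [h1] at h
    nlinarith
  rw [torusNhd, measure_biUnion_finset]
  · simp_rw [volume_ball_torus _ hρ hρ1]
    rw [Finset.sum_const, nsmul_eq_mul, ENNReal.ofReal_mul (by positivity), ENNReal.ofReal_natCast]
  · intro p hp p' hp' hpp'
    refine Set.disjoint_left.mpr fun x hx hx' => hpp' ?_
    have hdist : dist (fun j => ((p j / d : ℝ) : AddCircle (1:ℝ)))
        (fun j => ((p' j / d : ℝ) : AddCircle (1:ℝ))) < 2 * ρ :=
      (dist_triangle_left _ _ x).trans_lt (by
        rw [Metric.mem_ball] at hx hx'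
        linarith)
    obtain ⟨z, ⟨q, hq, k, rfl⟩, hz⟩ := exists_mem_liftSet_of_mem_torusNhd
      (P := fun _ => {p'}) hd (y := fun j => p j / d) (ρ := 2 * ρ)
      (by simpa [torusNhd] using hdist)
    obtain rfl : q = p' := by simpa using hq
    have hdp : (d : ℝ) • (fun j => p j / d) = p := by
      ext j
      simp only [Pi.smul_apply, smul_eq_mul]
      field_simp
    rw [hdp] at hz
    have hp0 : p ∈ liftSet m P d := ⟨p, hp, 0, by ext; simp⟩
    have heq : p = q + (d : ℝ) • fun j => ((k j : ℤ) : ℝ) := by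
      by_contra hcon
      have := hsep p hp0 _ ⟨q, hp', k, rfl⟩ hcon
      linarith
    ext j
    have hj : p j = q j + d * k j := by simpa using congrFun heq j
    have h1 := hrep p hp j
    have h2 := hrep q hp' j
    have hk1 : k j < 1 := by
      have : (d : ℝ) * k j < d * 1 := by linarith
      exact_mod_cast lt_of_mul_lt_mul_left this hd0.le
    have hk2 : -1 < k j := by
      have : (d : ℝ) * (-1) < d * k j := by linarith
      exact_mod_cast lt_of_mul_lt_mul_left this hd0.le
    have hk0 : k j = 0 := by omega
    simpa [hk0] using hj
  · exact fun p _ => measurableSet_ball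

lemma limsup_subset_limsupSet {m n : ℕ} {P : ℕ → Finset (Fin m → ℝ)} {ψ : (Fin n → ℕ) → ℝ}
    {v : ℕ → Fin n → ℕ} (hv0 : ∀ k, v k ≠ 0) (hv : Tendsto v atTop cofinite)
    {E : ℕ → Set (Fin n → Fin m → AddCircle (1:ℝ))}
    (hE : ∀ k, E k ⊆ approxSet m n P (v k) (ψ (v k))) :
    limsup E atTop ⊆ limsupSet m n P ψ := by
  intro X hX
  rw [mem_limsup_iff_frequently_mem] at hX
  refine frequently_cofinite_iff_infinite.mp (hv.frequently (hX.mono fun k hk => ?_))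
  exact ⟨hv0 k, hE k hk⟩

/-- **Large values of `ψ` force positive, resp. full, measure.** Let `P` be relatively
well-spread with constants `a, c > 0` (witnessed by refinements `P'`). If infinitely many
`q ∈ ℤ₊^n` satisfy `ψ(q) ≥ (a/2)·gcd(q)/(#P(gcd q))^{1/m}`, then
`Leb(W_{n,m}^P(ψ)) ≥ a^m c > 0`; if moreover for infinitely many `Q ≥ 1` there is such a
`q` with `|q/gcd q| ≥ Q`, then `Leb(W_{n,m}^P(ψ)) = 1`. -/
theorem large_psi_positive_measure (m n : ℕ) (hm : 1 ≤ m) (hn : 1 ≤ n)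
    (P P' : ℕ → Finset (Fin m → ℝ))
    (hrep : ∀ d : ℕ, 1 ≤ d → ∀ p ∈ P d, ∀ j, (0:ℝ) ≤ p j ∧ p j < d)
    (hne : ∀ d : ℕ, 1 ≤ d → (P d).Nonempty)
    (a b c : ℝ) (ha : 0 < a) (hb : 0 < b) (hc : 0 < c)
    (hsub : ∀ d, P' d ⊆ P d)
    (hcard : ∀ d : ℕ, 1 ≤ d → c * ((P d).card : ℝ) ≤ ((P' d).card : ℝ))
    (hspread : ∀ d : ℕ, 1 ≤ d → ∀ x ∈ liftSet m P' d, ∀ y ∈ liftSet m P' d, x ≠ y →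
      max b (a * d / (((P d).card : ℝ) ^ ((1:ℝ) / m))) ≤ ‖x - y‖)
    (ψ : (Fin n → ℕ) → ℝ) (hψ0 : ∀ v, 0 ≤ ψ v)
    (hinf : {v : Fin n → ℕ | v ≠ 0 ∧
      a / 2 * ((Finset.univ.gcd v : ℕ) : ℝ) / (((P (Finset.univ.gcd v)).card : ℝ) ^ ((1:ℝ) / m))
        ≤ ψ v}.Infinite) :
    ENNReal.ofReal (a ^ m * c) ≤ volume (limsupSet m n P ψ) ∧
    ((∃ᶠ Q : ℕ in atTop, ∃ v : Fin n → ℕ, v ≠ 0 ∧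
        a / 2 * ((Finset.univ.gcd v : ℕ) : ℝ) / (((P (Finset.univ.gcd v)).card : ℝ) ^ ((1:ℝ) / m))
          ≤ ψ v ∧ Q * Finset.univ.gcd v ≤ Finset.univ.sup v) →
      volume (limsupSet m n P ψ) = 1) := by
  have hgcd : ∀ v : Fin n → ℕ, v ≠ 0 → 1 ≤ Finset.univ.gcd v := fun v hv =>
    Nat.one_le_iff_ne_zero.mpr fun h => hv <| funext fun i =>
      Finset.gcd_eq_zero_iff.mp h i (Finset.mem_univ i)
  have hquot : ∀ v : Fin n → ℕ, ∃ w : Fin n → ℕ, ∀ i, v i = Finset.univ.gcd v * w i := fun v =>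
    Classical.skolem.mp fun i => Finset.gcd_dvd (Finset.mem_univ i)
  choose w hw using hquot
  have hw0 : ∀ v : Fin n → ℕ, v ≠ 0 → w v ≠ 0 := by
    intro v hv h
    refine hv (funext fun i => ?_)
    rw [hw v i, h]
    simp
  set ρ : ℕ → ℝ := fun d => a / 2 / (((P d).card : ℝ) ^ ((1:ℝ) / m)) with hρ_def
  have hcardpos : ∀ d, 1 ≤ d → (0:ℝ) < (P d).card := fun d hd => by
    exact_mod_cast (hne d hd).card_pos
  have hρ : ∀ d, 1 ≤ d → 0 < ρ d := fun d hd => by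
    have := hcardpos d hd
    positivity
  have hρpow : ∀ d, 1 ≤ d → (2 * ρ d) ^ m = a ^ m / (P d).card := by
    intro d hd
    have h2 : 2 * ρ d = a / (((P d).card : ℝ) ^ ((1:ℝ) / m)) := by
      simp only [hρ_def]
      ring
    rw [h2, div_pow, one_div, Real.rpow_inv_natCast_pow (hcardpos d hd).le (by omega)]
  set E : (Fin n → ℕ) → Set (Fin n → Fin m → AddCircle (1:ℝ)) := fun v =>
    rowCombination m (w v) ⁻¹'
      torusNhd (P' (Finset.univ.gcd v)) (Finset.univ.gcd v) (ρ (Finset.univ.gcd v)) with hE_def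
  have hEmeas : ∀ v, MeasurableSet (E v) := fun v =>
    ((isOpen_torusNhd _ _ _).preimage (continuous_rowCombination m (w v))).measurableSet
  have hEvol : ∀ v, v ≠ 0 → ENNReal.ofReal (a ^ m * c) ≤ volume (E v) := by
    intro v hv
    have hd := hgcd v hv
    have hN := hcardpos _ hd
    have hle := hcard _ hd
    have hne' : (P' (Finset.univ.gcd v)).Nonempty := by
      rw [← Finset.card_pos]
      exact_mod_cast (mul_pos hc hN).trans_le hle
    rw [(measurePreserving_rowCombination m (hw0 v hv)).measure_preimage
      (isOpen_torusNhd _ _ _).measurableSet.nullMeasurableSet,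
      volume_torusNhd hm hd (fun p hp => hrep _ hd p (hsub _ hp)) hne' (hρ _ hd), hρpow _ hd]
    · refine ENNReal.ofReal_le_ofReal ?_
      rw [mul_div_assoc', le_div_iff₀ hN]
      nlinarith [mul_le_mul_of_nonneg_left hle (pow_pos ha m).le]
    · intro x hx y hy hxy
      refine le_trans (le_of_eq ?_) ((le_max_right _ _).trans (hspread _ hd x hx y hy hxy))
      simp only [hρ_def]
      ring
  have hEsub : ∀ v, v ≠ 0 → a / 2 * ((Finset.univ.gcd v : ℕ) : ℝ) /
      (((P (Finset.univ.gcd v)).card : ℝ) ^ ((1:ℝ) / m)) ≤ ψ v →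
      E v ⊆ approxSet m n P v (ψ v) := by
    intro v hv hψ
    refine rowCombination_preimage_subset_approxSet hsub (hgcd v hv) (hw v)
      (le_trans (le_of_eq ?_) hψ)
    simp only [hρ_def]
    ring
  have : IsProbabilityMeasure (volume : Measure (AddCircle (1:ℝ))) :=
    ⟨by simp⟩
  refine ⟨?_, fun hfreq => ?_⟩
  · set u : ℕ → Fin n → ℕ := fun k => hinf.natEmbedding _ k
    have huinj : Function.Injective u :=
      Subtype.val_injective.comp (hinf.natEmbedding _).injective
    have hmem : ∀ k, u k ≠ 0 ∧ _ := fun k => (hinf.natEmbedding _ k).2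
    refine (le_measure_limsup_of_forall_le (fun k => hEmeas (u k))
      fun k => hEvol _ (hmem k).1).trans (measure_mono ?_)
    exact limsup_subset_limsupSet (fun k => (hmem k).1)
      (Nat.cofinite_eq_atTop ▸ huinj.tendsto_cofinite) fun k => hEsub _ (hmem k).1 (hmem k).2
  · have hseq : ∀ N : ℕ, ∃ v : Fin n → ℕ, v ≠ 0 ∧ a / 2 * ((Finset.univ.gcd v : ℕ) : ℝ) /
        (((P (Finset.univ.gcd v)).card : ℝ) ^ ((1:ℝ) / m)) ≤ ψ v ∧
        (N + 1) * Finset.univ.gcd v ≤ Finset.univ.sup v := by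
      intro N
      obtain ⟨Q, hQ, v, hv, hψ, hsup⟩ := frequently_atTop.mp hfreq (N + 1)
      exact ⟨v, hv, hψ, (Nat.mul_le_mul_right _ hQ).trans hsup⟩
    choose u hu0 huψ husup using hseq
    have : Nonempty (Fin n) := ⟨⟨0, hn⟩⟩
    have hentry : ∀ N, ∃ i, N + 1 ≤ w (u N) i := by
      intro N
      obtain ⟨i, -, hi⟩ := Finset.exists_mem_eq_sup Finset.univ Finset.univ_nonempty (u N)
      refine ⟨i, Nat.le_of_mul_le_mul_left ?_ (hgcd _ (hu0 N))⟩
      rw [← hw, ← hi, mul_comm]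
      exact husup N
    have hucof : Tendsto u atTop cofinite := by
      have hsuptop : Tendsto (fun N => Finset.univ.sup (u N)) atTop atTop :=
        tendsto_atTop_mono (fun N => (Nat.le_succ N).trans
          ((Nat.le_mul_of_pos_right _ (hgcd _ (hu0 N))).trans (husup N))) tendsto_id
      refine Tendsto.of_tendsto_comp (g := fun v : Fin n → ℕ => Finset.univ.sup v)
        (Nat.cofinite_eq_atTop ▸ hsuptop) (comap_cofinite_le _)
    have hδ0 : ENNReal.ofReal (a ^ m * c) ≠ 0 := by
      rw [ne_eq, ENNReal.ofReal_eq_zero, not_le]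
      positivity
    have hone := measure_limsup_eq_one_of_dense_periods (μ := volume)
      (fun k => hEmeas (u k)) hδ0 (fun k => hEvol _ (hu0 k)) ?_
    · refine le_antisymm prob_le_one (hone.symm.le.trans (measure_mono ?_))
      exact limsup_subset_limsupSet hu0 hucof fun k => hEsub _ (hu0 k) (huψ k)
    · intro U hU
      obtain ⟨ε, hε, hεU⟩ := Metric.mem_nhds_iff.mp hU
      filter_upwards [tendsto_one_div_add_atTop_nhds_zero_nat.eventually (gt_mem_nhds hε)]
        with k hk t
      obtain ⟨i, hi⟩ := hentry k
      obtain ⟨X, hX, hXn⟩ := exists_rowCombination_eq_norm_le (w (u k)) i (by omega)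
        (rowCombination m (w (u k)) t)
      refine ⟨t - X, hεU ?_, fun x => ?_⟩
      · rw [sub_sub_cancel, mem_ball_zero_iff]
        refine hXn.trans_lt (lt_of_le_of_lt ?_ hk)
        gcongr
        exact_mod_cast hi
      · simp [hE_def, hX]
end

section
/- Fix m, n ≥ 1 and let P be relatively uniformly discrete with constants b, c > 0. Suppose ψ : ℤ₊^n → ℝ₊ satisfies ψ(q) ≤ b/2 for all q, Ψ(d) = (Σ_{gcd(q)=d} ψ(q)^m)^{1/m} < ∞ for all d, and limsup_{d→∞} Ψ(d)/d > δ for some δ > 0. Then Leb(W_{n,m}^P(ψ)) > 0. If in addition #P(d) → ∞ as d → ∞, then Leb(W_{n,m}^P(ψ)) = 1. -/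
open MeasureTheory Filter
open scoped ENNReal

instance isProbabilityMeasure_volume_addCircle_one :
    IsProbabilityMeasure (volume : Measure (AddCircle (1:ℝ))) := ⟨by simp⟩

instance borelSpace_pi_pi_addCircle_one (m n : ℕ) :
    BorelSpace (Fin n → Fin m → AddCircle (1:ℝ)) :=
  Pi.borelSpace (X := fun _ : Fin n => Fin m → AddCircle (1:ℝ))

instance isAddHaarMeasure_volume_pi_pi_addCircle_one (m n : ℕ) :
    (volume : Measure (Fin n → Fin m → AddCircle (1:ℝ))).IsAddHaarMeasure :=
  Measure.pi.isAddHaarMeasure (α := fun _ : Fin n => Fin m → AddCircle (1:ℝ)) fun _ => volume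

/-- The homomorphism `X ↦ qX` from `𝕋^{nm}` to `𝕋^m`. -/
def torusMul (m : ℕ) {n : ℕ} (q : Fin n → ℕ) :
    (Fin n → Fin m → AddCircle (1:ℝ)) →+ (Fin m → AddCircle (1:ℝ)) where
  toFun X := fun j => ∑ i, q i • X i j
  map_zero' := by ext j; simp
  map_add' X Y := by ext j; simp [smul_add, Finset.sum_add_distrib]

lemma torusMul_apply {m n : ℕ} (q : Fin n → ℕ) (X : Fin n → Fin m → AddCircle (1:ℝ))
    (j : Fin m) : torusMul m q X j = ∑ i, q i • X i j := rfl

lemma continuous_torusMul (m : ℕ) {n : ℕ} (q : Fin n → ℕ) : Continuous (torusMul m q) := by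
  refine continuous_pi fun j => ?_
  simp only [torusMul_apply]
  fun_prop

lemma torusMul_coe {m n : ℕ} (q : Fin n → ℕ) (Y : Fin n → Fin m → ℝ) (j : Fin m) :
    torusMul m q (fun i j => (Y i j : AddCircle (1:ℝ))) j
      = ((∑ i, (q i : ℝ) * Y i j : ℝ) : AddCircle (1:ℝ)) := by
  rw [torusMul_apply, ← QuotientAddGroup.mk'_apply, map_sum]
  refine Finset.sum_congr rfl fun i _ => ?_
  rw [← nsmul_eq_mul, map_nsmul, QuotientAddGroup.mk'_apply]

lemma exists_torus_lift {ι : Type*} (w : ι → AddCircle (1:ℝ)) :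
    ∃ y : ι → ℝ, ∀ j, (y j : AddCircle (1:ℝ)) = w j := by
  choose y hy using fun j => QuotientAddGroup.mk_surjective (w j)
  exact ⟨y, hy⟩

lemma surjective_torusMul (m : ℕ) {n : ℕ} {q : Fin n → ℕ} (hq : q ≠ 0) :
    Function.Surjective (torusMul m q) := by
  intro w
  obtain ⟨y, hy⟩ := exists_torus_lift w
  obtain ⟨i₀, hi₀⟩ := Function.ne_iff.mp hq
  have h0 : (q i₀ : ℝ) ≠ 0 := by exact_mod_cast hi₀
  refine ⟨fun i j => ((if i = i₀ then y j / q i₀ else 0 : ℝ) : AddCircle (1:ℝ)), ?_⟩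
  ext j
  rw [torusMul_coe q (fun i j => if i = i₀ then y j / q i₀ else 0), ← hy j]
  simp [mul_div_cancel₀ _ h0]

lemma surjective_torusMul_prod (m : ℕ) {n : ℕ} {q q' : Fin n → ℕ} {a b : Fin n}
    (h : q a * q' b ≠ q b * q' a) :
    Function.Surjective ((torusMul m q).prod (torusMul m q')) := by
  rintro ⟨u, w⟩
  obtain ⟨x, hx⟩ := exists_torus_lift u
  obtain ⟨y, hy⟩ := exists_torus_lift w
  have hab : a ≠ b := by rintro rfl; exact h rfl
  set D : ℝ := (q a : ℝ) * q' b - q b * q' a with hD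
  have hD0 : D ≠ 0 := sub_ne_zero.mpr (by exact_mod_cast h)
  set Y : Fin n → Fin m → ℝ := fun i j =>
    (if i = a then (x j * q' b - y j * q b) / D else 0) +
      if i = b then (y j * q a - x j * q' a) / D else 0 with hY
  refine ⟨fun i j => (Y i j : AddCircle (1:ℝ)), ?_⟩
  have key : ∀ (r : Fin n → ℕ) j, ∑ i, (r i : ℝ) * Y i j =
      r a * ((x j * q' b - y j * q b) / D) + r b * ((y j * q a - x j * q' a) / D) := by
    intro r j
    simp [hY, mul_add, Finset.sum_add_distrib]
  refine Prod.ext ?_ ?_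
  · ext j
    rw [AddMonoidHom.prod_apply]
    dsimp only
    rw [torusMul_coe, key, ← hx j]
    congr 1
    field_simp
    rw [hD]; ring
  · ext j
    rw [AddMonoidHom.prod_apply]
    dsimp only
    rw [torusMul_coe, key, ← hy j]
    congr 1
    field_simp
    rw [hD]; ring

lemma measurePreserving_torusMul (m : ℕ) {n : ℕ} {q : Fin n → ℕ} (hq : q ≠ 0) :
    MeasurePreserving (torusMul m q) volume volume :=
  (torusMul m q).measurePreserving (continuous_torusMul m q) (surjective_torusMul m hq)
    (by simp)

/-- Preimages of `X ↦ qX` and `X ↦ q'X` are independent when `q` and `q'` are not parallel. -/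
lemma measureReal_torusMul_preimage_inter (m : ℕ) {n : ℕ} {q q' : Fin n → ℕ} {a b : Fin n}
    (h : q a * q' b ≠ q b * q' a) {s t : Set (Fin m → AddCircle (1:ℝ))}
    (hs : MeasurableSet s) (ht : MeasurableSet t) :
    volume.real (torusMul m q ⁻¹' s ∩ torusMul m q' ⁻¹' t) = volume.real s * volume.real t := by
  have : Measure.IsAddHaarMeasure ((volume : Measure (Fin m → AddCircle (1:ℝ))).prod
      (volume : Measure (Fin m → AddCircle (1:ℝ)))) :=
    Measure.prod.instIsAddHaarMeasure _ _
  have hmp : MeasurePreserving ((torusMul m q).prod (torusMul m q')) volume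
      ((volume : Measure (Fin m → AddCircle (1:ℝ))).prod volume) :=
    AddMonoidHom.measurePreserving
      ((continuous_torusMul m q).prodMk (continuous_torusMul m q'))
      (surjective_torusMul_prod m h) (by simp)
  have := hmp.measureReal_preimage (hs.prod ht).nullMeasurableSet
  rw [measureReal_prod_prod] at this
  exact this

lemma exists_minor_ne_of_gcd_eq {n : ℕ} {q q' : Fin n → ℕ} (hg : Finset.univ.gcd q ≠ 0)
    (h : Finset.univ.gcd q = Finset.univ.gcd q') (hne : q ≠ q') :
    ∃ a b, q a * q' b ≠ q b * q' a := by
  by_contra! H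
  refine hne (funext fun j => ?_)
  have h1 : Finset.univ.gcd (fun i => q i * q' j) = Finset.univ.gcd (fun i => q j * q' i) :=
    Finset.gcd_congr rfl fun i _ => H i j
  rw [Finset.gcd_mul_left, Finset.gcd_mul_right, ← h] at h1
  simp only [normalize_eq] at h1
  rw [mul_comm] at h1
  exact (Nat.eq_of_mul_eq_mul_right (Nat.pos_of_ne_zero hg) h1).symm

/-- The points `w` of `𝕋^m` for which `d w` lies within (strict) distance `r` of `S`. -/
def torusBalls (m : ℕ) (S : Finset (Fin m → ℝ)) (d : ℕ) (r : ℝ) :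
    Set (Fin m → AddCircle (1:ℝ)) :=
  ⋃ p ∈ S, Metric.ball (fun j => ((p j / d : ℝ) : AddCircle (1:ℝ))) (r / d)

lemma measurableSet_torusBalls (m : ℕ) (S : Finset (Fin m → ℝ)) (d : ℕ) (r : ℝ) :
    MeasurableSet (torusBalls m S d r) :=
  S.measurableSet_biUnion fun _ _ => Metric.isOpen_ball.measurableSet

lemma preimage_torusBalls_subset {m n : ℕ} (P : ℕ → Finset (Fin m → ℝ))
    {S : Finset (Fin m → ℝ)} {q q' : Fin n → ℕ} {d : ℕ} (hd : d ≠ 0)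
    (hg : Finset.univ.gcd q = d) (hS : S ⊆ P d) (hq : ∀ i, q i = d * q' i) (r : ℝ) :
    torusMul m q' ⁻¹' torusBalls m S d r ⊆ approxSet m n P q r := by
  intro X hX
  simp only [torusBalls, Set.mem_preimage, Set.mem_iUnion, Metric.mem_ball] at hX
  obtain ⟨p, hp, hX⟩ := hX
  have hd' : (0:ℝ) < d := by exact_mod_cast Nat.pos_of_ne_zero hd
  choose Y hY using fun i => exists_torus_lift (X i)
  have hXY : X = fun i j => (Y i j : AddCircle (1:ℝ)) := by ext i j; exact (hY i j).symm
  set s : Fin m → ℝ := fun j => ∑ i, (q' i : ℝ) * Y i j with hs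
  refine ⟨Y, hY, p + (d : ℝ) • fun j => ((round (s j - p j / d) : ℤ) : ℝ),
    ⟨p, hg ▸ hS hp, _, by rw [hg]⟩, ?_⟩
  have hr : 0 < r / d := dist_nonneg.trans_lt hX
  have hr' : 0 < r := by simpa [hd'] using hr
  refine (pi_norm_le_iff_of_nonneg hr'.le).mpr fun j => ?_
  have hj : dist (torusMul m q' X j) ((p j / d : ℝ) : AddCircle (1:ℝ)) < r / d :=
    (dist_le_pi_dist _ _ j).trans_lt hX
  rw [hXY, torusMul_coe, dist_eq_norm, ← QuotientAddGroup.mk_sub] at hj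
  erw [UnitAddCircle.norm_eq] at hj
  have hsum : ∑ i, (q i : ℝ) * Y i j = d * s j := by
    rw [hs, Finset.mul_sum]
    exact Finset.sum_congr rfl fun i _ => by rw [hq i]; push_cast; ring
  have : (∑ i, (q i : ℝ) * Y i j) - (p j + d * (round (s j - p j / d) : ℝ))
      = d * (s j - p j / d - round (s j - p j / d)) := by
    rw [hsum]; field_simp; ring
  simp only [Pi.sub_apply, Pi.add_apply, Pi.smul_apply, smul_eq_mul, Real.norm_eq_abs]
  rw [this, abs_mul, abs_of_pos hd', mul_comm]
  exact ((lt_div_iff₀ hd').mp hj).le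

lemma measureReal_torus_ball {m : ℕ} (hm : m ≠ 0) (x : Fin m → AddCircle (1:ℝ)) {r : ℝ}
    (hr0 : 0 ≤ r) (hr : 2 * r ≤ 1) : volume.real (Metric.ball x r) = (2 * r) ^ m := by
  rcases hr0.eq_or_lt with rfl | hr0
  · simp [hm]
  · rw [measureReal_def, volume_pi_ball x hr0, ENNReal.toReal_prod]
    simp_rw [← measure_congr (AddCircle.closedBall_ae_eq_ball), AddCircle.volume_closedBall,
      min_eq_right hr, ENNReal.toReal_ofReal (by positivity : 0 ≤ 2 * r)]
    simp

lemma measureReal_torusBalls {m : ℕ} (hm : m ≠ 0) {P : ℕ → Finset (Fin m → ℝ)} {d : ℕ}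
    (hd : d ≠ 0) {b r : ℝ} (hb : 0 < b) (hr0 : 0 ≤ r) (hrb : r ≤ b / 2)
    (hrep : ∀ p ∈ P d, ∀ j, (0:ℝ) ≤ p j ∧ p j < d)
    (hdisc : ∀ x ∈ liftSet m P d, ∀ y ∈ liftSet m P d, x ≠ y → b ≤ ‖x - y‖) :
    volume.real (torusBalls m (P d) d r) = (P d).card * (2 * (r / d)) ^ m := by
  have hd' : (0:ℝ) < d := by exact_mod_cast Nat.pos_of_ne_zero hd
  have hmem : ∀ p ∈ P d, p ∈ liftSet m P d := fun p hp => ⟨p, hp, 0, by ext; simp⟩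
  have hdisj : (P d : Set (Fin m → ℝ)).PairwiseDisjoint
      fun p => Metric.ball (fun j => ((p j / d : ℝ) : AddCircle (1:ℝ))) (r / d) := by
    intro p hp p' hp' hne
    refine Metric.ball_disjoint_ball ?_
    by_contra! hlt
    set k : Fin m → ℤ := fun j => round (p j / d - p' j / d)
    set z : Fin m → ℝ := p' + (d : ℝ) • fun j => ((k j : ℤ) : ℝ) with hz
    have hpz : p ≠ z := by
      intro h
      apply hne
      ext j
      have hj : p j = p' j + d * (k j : ℝ) := congrFun h j
      obtain ⟨h1, h2⟩ := hrep p hp j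
      obtain ⟨h3, h4⟩ := hrep p' hp' j
      have hk1 : (k j : ℝ) < 1 := by
        by_contra! hk
        nlinarith
      have hk2 : (-1 : ℝ) < k j := by
        by_contra! hk
        nlinarith
      have hk : k j = 0 := by
        have h5 : k j < 1 := by exact_mod_cast hk1
        have h6 : -1 < k j := by exact_mod_cast hk2
        omega
      simpa [hk] using hj
    have hbz := hdisc p (hmem p hp) z ⟨p', hp', k, rfl⟩ hpz
    refine hbz.not_gt ((pi_norm_lt_iff hb).mpr fun j => ?_)
    have hj := (dist_le_pi_dist (fun j => ((p j / d : ℝ) : AddCircle (1:ℝ)))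
      (fun j => ((p' j / d : ℝ) : AddCircle (1:ℝ))) j).trans_lt hlt
    rw [dist_eq_norm, ← QuotientAddGroup.mk_sub] at hj
    erw [UnitAddCircle.norm_eq] at hj
    have h1 : (p - z) j = d * (p j / d - p' j / d - k j) := by
      simp only [hz, Pi.sub_apply, Pi.add_apply, Pi.smul_apply, smul_eq_mul]
      field_simp; ring
    rw [h1, Real.norm_eq_abs, abs_mul, abs_of_pos hd', mul_comm]
    rw [← add_div] at hj
    have := (lt_div_iff₀ hd').mp hj
    linarith
  have hsmall : (P d).Nonempty → 2 * (r / d) ≤ 1 := by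
    rintro ⟨p, hp⟩
    have hbd := hdisc p (hmem p hp) (p + (d : ℝ) • fun _ => (((1 : ℤ)) : ℝ))
      ⟨p, hp, fun _ => 1, rfl⟩ (by
        intro h
        have := congrFun h ⟨0, Nat.pos_of_ne_zero hm⟩
        simp [hd] at this)
    have : b ≤ d := by
      refine hbd.trans ((pi_norm_le_iff_of_nonneg hd'.le).mpr fun j => ?_)
      simp
    rw [← mul_div_assoc, div_le_one hd']
    linarith
  rw [torusBalls, measureReal_biUnion_finset hdisj
    fun _ _ => Metric.isOpen_ball.measurableSet]
  rw [Finset.sum_congr rfl fun p hp =>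
    measureReal_torus_ball hm _ (by positivity) (hsmall ⟨p, hp⟩)]
  simp

/-- The **Chung–Erdős inequality** for finitely many pairwise independent events. -/
lemma div_le_measureReal_biUnion_of_pairwise_indep {Ω ι : Type*} [MeasurableSpace Ω]
    {μ : Measure Ω} [IsProbabilityMeasure μ] (F : Finset ι) {A : ι → Set Ω}
    (hA : ∀ i ∈ F, MeasurableSet (A i))
    (hind : ∀ i ∈ F, ∀ j ∈ F, i ≠ j → μ.real (A i ∩ A j) = μ.real (A i) * μ.real (A j))
    {K : ℝ} (hK0 : 0 ≤ K) (hK : K ≤ ∑ i ∈ F, μ.real (A i)) :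
    K / (1 + K) ≤ μ.real (⋃ i ∈ F, A i) := by
  classical
  set S := ∑ i ∈ F, μ.real (A i) with hS
  have hS0 : 0 ≤ S := hK0.trans hK
  set U := ⋃ i ∈ F, A i with hU
  have hUm : MeasurableSet U := F.measurableSet_biUnion hA
  set N : Ω → ℝ := fun ω => ∑ i ∈ F, (A i).indicator 1 ω with hN
  have hint : ∀ s : Set Ω, MeasurableSet s → Integrable (s.indicator (1 : Ω → ℝ)) μ :=
    fun s hs => (integrable_const (1:ℝ)).indicator hs
  have hNint : Integrable N μ := integrable_finsetSum _ fun i hi => hint _ (hA i hi)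
  have hNS : ∫ ω, N ω ∂μ = S := by
    rw [integral_finsetSum _ fun i hi => hint _ (hA i hi)]
    exact Finset.sum_congr rfl fun i hi => integral_indicator_one (hA i hi)
  have hsq : ∀ ω, N ω ^ 2 = ∑ i ∈ F, ∑ j ∈ F, (A i ∩ A j).indicator 1 ω := by
    intro ω
    simp only [hN, sq, Finset.sum_mul_sum, Set.inter_indicator_one, Pi.mul_apply]
  have hint2 : ∀ i ∈ F, ∀ j ∈ F, Integrable ((A i ∩ A j).indicator (1 : Ω → ℝ)) μ :=
    fun i hi j hj => hint _ ((hA i hi).inter (hA j hj))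
  have hN2int : Integrable (fun ω => N ω ^ 2) μ := by
    simp_rw [hsq]
    exact integrable_finsetSum _ fun i hi => integrable_finsetSum _ fun j hj => hint2 i hi j hj
  have hN2 : ∫ ω, N ω ^ 2 ∂μ ≤ S ^ 2 + S := by
    simp_rw [hsq]
    rw [integral_finsetSum _ fun i hi => integrable_finsetSum _ fun j hj => hint2 i hi j hj]
    have : ∀ i ∈ F, ∫ ω, ∑ j ∈ F, (A i ∩ A j).indicator (1 : Ω → ℝ) ω ∂μ
        ≤ μ.real (A i) * S + μ.real (A i) := by
      intro i hi
      rw [integral_finsetSum _ fun j hj => hint2 i hi j hj]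
      calc ∑ j ∈ F, ∫ ω, (A i ∩ A j).indicator (1 : Ω → ℝ) ω ∂μ
          ≤ ∑ j ∈ F, (μ.real (A i) * μ.real (A j) + if i = j then μ.real (A i) else 0) := by
            refine Finset.sum_le_sum fun j hj => ?_
            rw [integral_indicator_one ((hA i hi).inter (hA j hj))]
            by_cases hij : i = j
            · subst hij
              simp only [Set.inter_self, if_true]
              exact le_add_of_nonneg_left (by positivity)
            · simp [hind i hi j hj hij, hij]
        _ = μ.real (A i) * S + μ.real (A i) := by
            rw [Finset.sum_add_distrib, ← Finset.mul_sum]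
            simp [hi, hS]
    refine (Finset.sum_le_sum this).trans_eq ?_
    rw [Finset.sum_add_distrib, ← Finset.sum_mul]
    ring
  set l : ℝ := 1 / (1 + S) with hl
  have hpt : ∀ ω, 2 * l * N ω - l ^ 2 * N ω ^ 2 ≤ U.indicator (1 : Ω → ℝ) ω := by
    intro ω
    by_cases hω : ω ∈ U
    · simp only [hω, Set.indicator_of_mem, Pi.one_apply]
      nlinarith [sq_nonneg (l * N ω - 1)]
    · have : N ω = 0 := by
        refine Finset.sum_eq_zero fun i hi => ?_
        exact Set.indicator_of_notMem (fun h => hω (Set.mem_biUnion hi h)) _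
      simp [hω, this]
  have hmain : 2 * l * S - l ^ 2 * (S ^ 2 + S) ≤ μ.real U := by
    rw [← integral_indicator_one hUm]
    refine le_trans ?_ (integral_mono ((hNint.const_mul _).sub (hN2int.const_mul _))
      (hint U hUm) hpt)
    simp only [Pi.sub_apply]
    rw [integral_sub (hNint.const_mul _) (hN2int.const_mul _), integral_const_mul,
      integral_const_mul, hNS]
    gcongr
  have heq : 2 * l * S - l ^ 2 * (S ^ 2 + S) = S / (1 + S) := by
    rw [hl]; field_simp; ring
  refine le_trans ?_ (heq ▸ hmain)
  rw [div_le_div_iff₀ (by positivity) (by positivity)]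
  nlinarith

/-- If frequently `t ≤ μ (E d)`, then the limsup of the sets `E d` has measure at least `t`. -/
lemma le_measure_frequently_mem {Ω : Type*} [MeasurableSpace Ω] {μ : Measure Ω}
    [IsFiniteMeasure μ] {E : ℕ → Set Ω} (hE : ∀ d, MeasurableSet (E d)) {t : ℝ≥0∞}
    (h : ∃ᶠ d in atTop, t ≤ μ (E d)) : t ≤ μ {ω | ∃ᶠ d in atTop, ω ∈ E d} := by
  have hset : {ω | ∃ᶠ d in atTop, ω ∈ E d} = ⋂ N, ⋃ d ≥ N, E d := by
    ext ω; simp [frequently_atTop]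
  have hanti : Antitone fun N : ℕ => ⋃ d ≥ N, E d := fun M N hMN =>
    Set.biUnion_subset_biUnion_left fun d (hd : N ≤ d) => hMN.trans hd
  rw [hset, hanti.measure_iInter
    (fun N => (MeasurableSet.iUnion fun d => .iUnion fun _ => hE d).nullMeasurableSet)
    ⟨0, measure_ne_top _ _⟩]
  refine le_iInf fun N => ?_
  obtain ⟨d, hd, ht⟩ := frequently_atTop.mp h N
  exact ht.trans (measure_mono (Set.subset_biUnion_of_mem (u := E) hd))

/-- The measure of the union of the approximation sets over the vectors of gcd `d` is bounded
below in terms of the number of points of `P d`. -/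
lemma exists_subset_iUnion_approxSet {m n : ℕ} (hm : m ≠ 0) {P P' : ℕ → Finset (Fin m → ℝ)}
    {d : ℕ} (hd : d ≠ 0) (hsub : P' d ⊆ P d)
    (hrep : ∀ p ∈ P d, ∀ j, (0:ℝ) ≤ p j ∧ p j < d) {b : ℝ} (hb : 0 < b)
    (hdisc : ∀ x ∈ liftSet m P' d, ∀ y ∈ liftSet m P' d, x ≠ y → b ≤ ‖x - y‖)
    {ψ : (Fin n → ℕ) → ℝ} (hψ0 : ∀ v, 0 ≤ ψ v) (hψb : ∀ v, ψ v ≤ b / 2) {δ : ℝ}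
    (hΨ : ENNReal.ofReal ((δ * d) ^ m)
      < ∑' v : {v : Fin n → ℕ // v ≠ 0 ∧ Finset.univ.gcd v = d}, ENNReal.ofReal (ψ v.1 ^ m))
    {K : ℝ} (hK0 : 0 ≤ K) (hK : K ≤ δ ^ m * (P' d).card) :
    ∃ E : Set (Fin n → Fin m → AddCircle (1:ℝ)), MeasurableSet E ∧
      ENNReal.ofReal (K / (1 + K)) ≤ volume E ∧
      ∀ X ∈ E, ∃ v : Fin n → ℕ, v ≠ 0 ∧ Finset.univ.gcd v = d ∧ X ∈ approxSet m n P v (ψ v) := by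
  have hd' : (0:ℝ) < d := by exact_mod_cast Nat.pos_of_ne_zero hd
  rw [ENNReal.tsum_eq_iSup_sum, lt_iSup_iff] at hΨ
  obtain ⟨F, hF⟩ := hΨ
  have hψm : ∀ v, 0 ≤ ψ v ^ m := fun v => pow_nonneg (hψ0 v) m
  rw [← ENNReal.ofReal_sum_of_nonneg fun v _ => hψm v.1] at hF
  have hF' : (δ * d) ^ m ≤ ∑ v ∈ F, ψ v.1 ^ m := (ENNReal.ofReal_lt_ofReal_iff'.mp hF).1.le
  have hdiv : ∀ v : {v : Fin n → ℕ // v ≠ 0 ∧ Finset.univ.gcd v = d},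
      ∀ i, v.1 i = d * (v.1 i / d) := by
    rintro ⟨v, _, hv⟩ i
    exact (Nat.mul_div_cancel' (hv ▸ Finset.gcd_dvd (Finset.mem_univ i))).symm
  set A : {v : Fin n → ℕ // v ≠ 0 ∧ Finset.univ.gcd v = d} →
      Set (Fin n → Fin m → AddCircle (1:ℝ)) :=
    fun v => torusMul m (fun i => v.1 i / d) ⁻¹' torusBalls m (P' d) d (ψ v.1) with hAdef
  have hball : ∀ r, MeasurableSet (torusBalls m (P' d) d r) := measurableSet_torusBalls m _ d
  have hAm : ∀ v, MeasurableSet (A v) := fun v =>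
    (continuous_torusMul m _).measurable (hball _)
  have hAμ : ∀ v, volume.real (A v) = volume.real (torusBalls m (P' d) d (ψ v.1)) := by
    intro v
    refine (measurePreserving_torusMul m ?_).measureReal_preimage (hball _).nullMeasurableSet
    intro h
    refine v.2.1 (funext fun i => ?_)
    rw [hdiv v i, congrFun h i]
    simp
  refine ⟨⋃ v ∈ F, A v, F.measurableSet_biUnion fun v _ => hAm v, ?_, ?_⟩
  · rw [ENNReal.ofReal_le_iff_le_toReal (measure_ne_top _ _)]
    refine div_le_measureReal_biUnion_of_pairwise_indep F (fun v _ => hAm v) ?_ hK0 ?_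
    · intro v _ w _ hvw
      obtain ⟨i, j, hij⟩ := exists_minor_ne_of_gcd_eq (by rw [v.2.2]; exact hd)
        (v.2.2.trans w.2.2.symm) (fun h => hvw (Subtype.ext h))
      rw [hAμ, hAμ]
      refine measureReal_torusMul_preimage_inter m (a := i) (b := j) ?_ (hball _) (hball _)
      intro h
      apply hij
      rw [hdiv v i, hdiv v j, hdiv w i, hdiv w j]
      linear_combination (d * d) * h
    · simp_rw [hAμ, measureReal_torusBalls hm hd hb (hψ0 _) (hψb _)
        (fun p hp => hrep p (hsub hp)) hdisc]
      have h2 : δ ^ m ≤ ∑ v ∈ F, (2 * (ψ v.1 / d)) ^ m := by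
        have h3 : δ ^ m ≤ ∑ v ∈ F, (ψ v.1 / d) ^ m := by
          simp_rw [div_pow]
          rw [← Finset.sum_div, le_div_iff₀ (by positivity), ← mul_pow]
          exact hF'
        refine h3.trans (Finset.sum_le_sum fun v _ => ?_)
        have : 0 ≤ ψ v.1 / d := div_nonneg (hψ0 _) hd'.le
        exact pow_le_pow_left₀ this (by linarith) m
      rw [← Finset.mul_sum, mul_comm]
      rw [mul_comm] at hK
      rw [mul_comm]
      exact hK.trans (mul_le_mul_of_nonneg_left h2 (Nat.cast_nonneg _))
  · intro X hX
    simp only [Set.mem_iUnion] at hX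
    obtain ⟨v, _, hv⟩ := hX
    exact ⟨v.1, v.2.1, v.2.2, preimage_torusBalls_subset P hd v.2.2 hsub (hdiv v) _ hv⟩

lemma mem_limsupSet_of_frequently {m n : ℕ} {P : ℕ → Finset (Fin m → ℝ)}
    {ψ : (Fin n → ℕ) → ℝ} {X : Fin n → Fin m → AddCircle (1:ℝ)}
    (h : ∃ᶠ d in atTop, ∃ v : Fin n → ℕ,
      v ≠ 0 ∧ Finset.univ.gcd v = d ∧ X ∈ approxSet m n P v (ψ v)) :
    X ∈ limsupSet m n P ψ := by
  intro hfin
  refine (Nat.frequently_atTop_iff_infinite.mp h) ((hfin.image fun v => Finset.univ.gcd v).subset ?_)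
  rintro d ⟨v, hv0, hvd, hv⟩
  exact ⟨v, ⟨hv0, hv⟩, hvd⟩

/-- **Positive / full measure from a large limsup of `Ψ(d)/d`.** Let `P` be relatively
uniformly discrete with constants `b, c > 0` (witnessed by refinements `P'`). Suppose
`ψ(q) ≤ b/2` for all `q`, each `Ψ(d)^m = ∑_{gcd(q)=d} ψ(q)^m` is finite, and
`limsup_{d→∞} Ψ(d)/d > δ` for some `δ > 0`. Then `Leb(W_{n,m}^P(ψ)) > 0`; if moreover
`#P(d) → ∞`, then `Leb(W_{n,m}^P(ψ)) = 1`. -/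
theorem positive_measure_of_limsup_Psi (m n : ℕ) (hm : 1 ≤ m) (hn : 1 ≤ n)
    (P P' : ℕ → Finset (Fin m → ℝ))
    (hrep : ∀ d : ℕ, 1 ≤ d → ∀ p ∈ P d, ∀ j, (0:ℝ) ≤ p j ∧ p j < d)
    (hne : ∀ d : ℕ, 1 ≤ d → (P d).Nonempty)
    (b c : ℝ) (hb : 0 < b) (hc : 0 < c)
    (hsub : ∀ d, P' d ⊆ P d)
    (hcard : ∀ d : ℕ, 1 ≤ d → c * ((P d).card : ℝ) ≤ ((P' d).card : ℝ))
    (hdisc : ∀ d : ℕ, 1 ≤ d → ∀ x ∈ liftSet m P' d, ∀ y ∈ liftSet m P' d, x ≠ y →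
      b ≤ ‖x - y‖)
    (ψ : (Fin n → ℕ) → ℝ) (hψ0 : ∀ v, 0 ≤ ψ v) (hψb : ∀ v, ψ v ≤ b / 2)
    (hPsifin : ∀ d : ℕ,
      ∑' v : {v : Fin n → ℕ // v ≠ 0 ∧ Finset.univ.gcd v = d},
        ENNReal.ofReal (ψ v.1 ^ m) ≠ ⊤)
    (δ : ℝ) (hδ : 0 < δ)
    (hlimsup : ∃ᶠ d : ℕ in atTop,
      ENNReal.ofReal ((δ * d) ^ m)
        < ∑' v : {v : Fin n → ℕ // v ≠ 0 ∧ Finset.univ.gcd v = d},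
            ENNReal.ofReal (ψ v.1 ^ m)) :
    0 < volume (limsupSet m n P ψ) ∧
    (Tendsto (fun d : ℕ => (P d).card) atTop atTop →
      volume (limsupSet m n P ψ) = 1) := by
  have key : ∀ K : ℝ, 0 ≤ K →
      (∃ᶠ d : ℕ in atTop, (ENNReal.ofReal ((δ * d) ^ m)
        < ∑' v : {v : Fin n → ℕ // v ≠ 0 ∧ Finset.univ.gcd v = d},
            ENNReal.ofReal (ψ v.1 ^ m)) ∧ K ≤ δ ^ m * (c * (P d).card)) →
      ENNReal.ofReal (K / (1 + K)) ≤ volume (limsupSet m n P ψ) := by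
    intro K hK0 hfreq
    have hex : ∀ d : ℕ, ∃ E : Set (Fin n → Fin m → AddCircle (1:ℝ)), MeasurableSet E ∧
        (∀ X ∈ E, ∃ v : Fin n → ℕ,
          v ≠ 0 ∧ Finset.univ.gcd v = d ∧ X ∈ approxSet m n P v (ψ v)) ∧
        (1 ≤ d → (ENNReal.ofReal ((δ * d) ^ m)
          < ∑' v : {v : Fin n → ℕ // v ≠ 0 ∧ Finset.univ.gcd v = d},
            ENNReal.ofReal (ψ v.1 ^ m)) ∧ K ≤ δ ^ m * (c * (P d).card) →
          ENNReal.ofReal (K / (1 + K)) ≤ volume E) := by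
      intro d
      by_cases h : 1 ≤ d ∧ (ENNReal.ofReal ((δ * d) ^ m)
          < ∑' v : {v : Fin n → ℕ // v ≠ 0 ∧ Finset.univ.gcd v = d},
            ENNReal.ofReal (ψ v.1 ^ m)) ∧ K ≤ δ ^ m * (c * (P d).card)
      · obtain ⟨hd, hΨ, hK⟩ := h
        obtain ⟨E, hE, hEv, hEs⟩ := exists_subset_iUnion_approxSet (by omega) (by omega)
          (hsub d) (hrep d hd) hb (hdisc d hd) hψ0 hψb hΨ hK0
          (hK.trans (mul_le_mul_of_nonneg_left (hcard d hd) (by positivity)))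
        exact ⟨E, hE, hEs, fun _ _ => hEv⟩
      · exact ⟨∅, .empty, by simp, fun h1 h2 => absurd ⟨h1, h2⟩ h⟩
    choose E hE hEs hEv using hex
    refine (le_measure_frequently_mem hE ?_).trans
      (measure_mono fun X hX => mem_limsupSet_of_frequently
        (Frequently.mono hX fun d hd => hEs d X hd))
    exact (hfreq.and_eventually (eventually_ge_atTop 1)).mono fun d hd => hEv d hd.2 hd.1
  constructor
  · refine lt_of_lt_of_le ?_ (key (δ ^ m * c) (by positivity) ?_)
    · exact ENNReal.ofReal_pos.mpr (by positivity)
    · refine (hlimsup.and_eventually (eventually_ge_atTop 1)).mono fun d hd => ⟨hd.1, ?_⟩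
      have h1 : (1:ℝ) ≤ (P d).card := by exact_mod_cast (hne d hd.2).card_pos
      exact mul_le_mul_of_nonneg_left (le_mul_of_one_le_right hc.le h1) (by positivity)
  · intro hP
    refine le_antisymm prob_le_one ?_
    have hlim : Tendsto (fun K : ℕ => ENNReal.ofReal ((K:ℝ) / (1 + K))) atTop (nhds 1) := by
      rw [← ENNReal.ofReal_one]
      refine ENNReal.tendsto_ofReal ?_
      simpa [add_comm] using tendsto_natCast_div_add_atTop (1:ℝ)
    refine le_of_tendsto' hlim fun K => key K (Nat.cast_nonneg K) ?_
    refine (hlimsup.and_eventually ?_).mono fun d hd => hd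
    have hP' : Tendsto (fun d : ℕ => δ ^ m * (c * ((P d).card : ℝ))) atTop atTop :=
      ((tendsto_natCast_atTop_atTop.comp hP).const_mul_atTop hc).const_mul_atTop (by positivity)
    exact hP'.eventually_ge_atTop (K:ℝ)
end
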